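/- arXiv:1707.00096 — 8 statements merged into one kernel-verified Lean document; each statement's English description precedes it below -/
import Mathlib

section
/- Every integer n can be written as n = a + b, where a and b are squarefree integers. -/
/-- A telescoping bound for the sum of the reciprocals of the odd squares starting at `9`. -/
theorem sum_inv_odd_sq_le (K : ℕ) :
    ∑ k ∈ Finset.range K, (1 : ℚ) / (2 * k + 3) ^ 2 ≤ 1 / 4 - 1 / (4 * ((K : ℚ) + 1)) := by
  induction K with
  | zero => norm_num
  | succ K ih =>
    rw [Finset.sum_range_succ]
    have h : (1 : ℚ) / (2 * K + 3) ^ 2 ≤ 1 / ((2 * K + 2) * (2 * K + 4)) := by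
      apply one_div_le_one_div_of_le (by positivity)
      nlinarith
    have e : (1 : ℚ) / ((2 * K + 2) * (2 * K + 4)) =
        1 / (4 * (K + 1)) - 1 / (4 * ((K + 1 : ℕ) + 1)) := by
      push_cast
      field_simp
      ring
    linarith

/-- Fewer than half of the integers in `(0, N]` fail to be squarefree. -/
theorem two_mul_card_not_squarefree_lt {N : ℕ} (hN : 0 < N) :
    2 * ((Finset.Ioc 0 N).filter fun m => ¬ Squarefree m).card < N := by
  have hsub : ((Finset.Ioc 0 N).filter fun m => ¬ Squarefree m) ⊆
      ((Finset.Ioc 0 N).filter fun m => 2 ^ 2 ∣ m) ∪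
        (Finset.range N).biUnion fun k =>
          (Finset.Ioc 0 N).filter fun m => (2 * k + 3) ^ 2 ∣ m := by
    intro m hm
    simp only [Finset.mem_filter, Finset.mem_Ioc, Nat.squarefree_iff_prime_squarefree] at hm
    obtain ⟨⟨hm0, hmN⟩, hm⟩ := hm
    push Not at hm
    obtain ⟨p, hp, hpm⟩ := hm
    simp only [Finset.mem_union, Finset.mem_biUnion, Finset.mem_filter, Finset.mem_Ioc,
      Finset.mem_range]
    rcases hp.eq_two_or_odd with rfl | hodd
    · exact Or.inl ⟨⟨hm0, hmN⟩, hpm⟩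
    · have h2 := hp.two_le
      have hle := Nat.le_of_dvd hm0 hpm
      have hpN : p ≤ N := by nlinarith
      refine Or.inr ⟨(p - 3) / 2, by omega, ⟨hm0, hmN⟩, ?_⟩
      rw [show 2 * ((p - 3) / 2) + 3 = p by omega, pow_two]
      exact hpm
  have hcard := (Finset.card_le_card hsub).trans ((Finset.card_union_le _ _).trans
    (Nat.add_le_add_left Finset.card_biUnion_le _))
  simp only [Nat.Ioc_filter_dvd_card_eq_div] at hcard
  have hN' : (0 : ℚ) < N := by exact_mod_cast hN
  have hq : (((Finset.Ioc 0 N).filter fun m => ¬ Squarefree m).card : ℚ) ≤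
      N * (1 / 4) + N * ∑ k ∈ Finset.range N, (1 : ℚ) / (2 * k + 3) ^ 2 := by
    refine (Nat.cast_le.mpr hcard).trans ?_
    rw [Finset.mul_sum]
    push_cast
    gcongr with k
    · refine Nat.cast_div_le.trans (le_of_eq ?_)
      norm_num
      ring
    · refine Nat.cast_div_le.trans (le_of_eq ?_)
      push_cast
      ring
  have hs : ∑ k ∈ Finset.range N, (1 : ℚ) / (2 * k + 3) ^ 2 < 1 / 4 :=
    (sum_inv_odd_sq_le N).trans_lt (sub_lt_self _ (by positivity))
  have := mul_lt_mul_of_pos_left hs hN'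
  have hlt : (2 : ℚ) * ((Finset.Ioc 0 N).filter fun m => ¬ Squarefree m).card < N := by
    linarith
  exact_mod_cast hlt

/-- Every natural number `n ≥ 2` is a sum of two squarefree natural numbers. -/
theorem Nat.exists_squarefree_add_squarefree {n : ℕ} (hn : 2 ≤ n) :
    ∃ a b : ℕ, Squarefree a ∧ Squarefree b ∧ n = a + b := by
  by_contra! h
  set B := (Finset.Ioc 0 (n - 1)).filter fun m => ¬ Squarefree m
  have hcov : Finset.Ioc 0 (n - 1) ⊆ B ∪ B.image fun m => n - m := by
    intro m hm
    have hm' := Finset.mem_Ioc.mp hm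
    by_cases hs : Squarefree m
    · refine Finset.mem_union_right _ (Finset.mem_image.mpr ⟨n - m, ?_, by omega⟩)
      refine Finset.mem_filter.mpr ⟨Finset.mem_Ioc.mpr (by omega), fun ht => ?_⟩
      exact h m (n - m) hs ht (by omega)
    · exact Finset.mem_union_left _ (Finset.mem_filter.mpr ⟨hm, hs⟩)
  have h1 := (Finset.card_le_card hcov).trans (Finset.card_union_le _ _)
  have h2 : (B.image fun m => n - m).card ≤ B.card := Finset.card_image_le
  have h3 : 2 * B.card < n - 1 := two_mul_card_not_squarefree_lt (by omega)
  rw [Nat.card_Ioc] at h1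
  omega

/-- Every natural number is a sum of two squarefree integers. -/
theorem Int.exists_squarefree_add_squarefree_natCast (n : ℕ) :
    ∃ a b : ℤ, Squarefree a ∧ Squarefree b ∧ (n : ℤ) = a + b := by
  have hneg : Squarefree (-1 : ℤ) := isUnit_one.neg.squarefree
  obtain rfl | rfl | hn : n = 0 ∨ n = 1 ∨ 2 ≤ n := by omega
  · exact ⟨1, -1, squarefree_one, hneg, by norm_num⟩
  · exact ⟨2, -1, Int.prime_two.squarefree, hneg, by norm_num⟩
  · obtain ⟨a, b, ha, hb, h⟩ := Nat.exists_squarefree_add_squarefree hn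
    exact ⟨a, b, Int.squarefree_natCast.mpr ha, Int.squarefree_natCast.mpr hb,
      by exact_mod_cast h⟩

/-- Every integer `n` can be written as `n = a + b` with `a` and `b` squarefree integers. -/
theorem every_int_sum_of_two_squarefree (n : ℤ) :
    ∃ a b : ℤ, Squarefree a ∧ Squarefree b ∧ n = a + b := by
  obtain ⟨a, b, ha, hb, h⟩ := Int.exists_squarefree_add_squarefree_natCast n.natAbs
  rcases Int.natAbs_eq n with hn | hn
  · exact ⟨a, b, ha, hb, hn.trans h⟩
  · refine ⟨-a, -b, ?_, ?_, by omega⟩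
    · rwa [← Int.squarefree_natAbs, Int.natAbs_neg, Int.squarefree_natAbs]
    · rwa [← Int.squarefree_natAbs, Int.natAbs_neg, Int.squarefree_natAbs]
end

section
/- Let k be a nonzero integer and let c_1, …, c_n, c'_1, …, c'_{n'} be integers such that all n + n' of them are pairwise distinct. Assume that for every prime p there exists an integer a_p such that p² does not divide k·a_p + c_i for every i ∈ {1, …, n}. Then there exist infinitely many integers a such that k·a + c_i is squarefree for every i ∈ {1, …, n} and k·a + c'_j is not squarefree for every j ∈ {1, …, n'}. -/
/-- In an interval of length `N`, at most `N / q + 1` terms of a progression whose difference is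
coprime to `q` are divisible by `q`. -/
theorem card_filter_dvd_progression_le (A d : ℤ) (q N : ℕ)
    (hA : IsCoprime (q : ℤ) A) :
    ((Finset.range N).filter fun t : ℕ => (q : ℤ) ∣ A * t + d).card ≤ N / q + 1 := by
  rw [← Finset.card_range (N / q + 1)]
  refine Finset.card_le_card_of_injOn (fun t => t / q) ?_ ?_
  · intro t ht
    simp only [Finset.coe_filter, Finset.mem_range, Set.mem_ofPred_eq] at ht
    simp only [Finset.coe_range, Set.mem_Iio]
    exact Nat.lt_succ_of_le (Nat.div_le_div_right ht.1.le)
  · intro t ht u hu htu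
    simp only [Finset.coe_filter, Finset.mem_range, Set.mem_ofPred_eq] at ht hu htu
    have h1 : (q : ℤ) ∣ A * ((t : ℤ) - u) := by
      have := dvd_sub ht.2 hu.2
      rwa [show A * (t : ℤ) + d - (A * u + d) = A * ((t : ℤ) - u) by ring] at this
    have h2 : (q : ℤ) ∣ (t : ℤ) - u := hA.dvd_of_dvd_mul_left h1
    have h3 : u ≡ t [MOD q] := (Nat.modEq_iff_dvd).2 h2
    rw [← Nat.div_add_mod t q, ← Nat.div_add_mod u q, htu, h3]

theorem exists_prime_sq_dvd_of_not_squarefree {m : ℤ} (hm : ¬ Squarefree m) :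
    ∃ p : ℕ, p.Prime ∧ (p : ℤ) ^ 2 ∣ m := by
  rw [← Int.squarefree_natAbs, Nat.squarefree_iff_prime_squarefree] at hm
  push Not at hm
  obtain ⟨p, hp, h⟩ := hm
  refine ⟨p, hp, ?_⟩
  rw [← Int.dvd_natAbs, pow_two]
  exact_mod_cast h

open Classical in
/-- Upper bound for the number of non-squarefree terms among the first `s ^ 2` terms of a
progression none of whose terms is divisible by the square of a prime `p ≤ B`. -/
theorem card_filter_not_squarefree_le (A d : ℤ) (hA : A ≠ 0) (B D s : ℕ) (hB : 0 < B)
    (hsmall : ∀ p : ℕ, p.Prime → p ≤ B → ∀ t : ℕ, ¬ (p : ℤ) ^ 2 ∣ A * t + d)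
    (hlarge : ∀ p : ℕ, p.Prime → B < p → IsCoprime (p : ℤ) A)
    (hD : A.natAbs + d.natAbs ≤ D) :
    (((Finset.range (s ^ 2)).filter fun t : ℕ => ¬ Squarefree (A * t + d)).card : ℚ) ≤
      1 + (s ^ 2 / B + D * s) := by
  set N := s ^ 2 with hN
  let Z := (Finset.range N).filter fun t : ℕ => A * t + d = 0
  let T : ℕ → Finset ℕ := fun m =>
    (Finset.range N).filter fun t : ℕ => m.Prime ∧ ((m ^ 2 : ℕ) : ℤ) ∣ A * t + d
  have hsub : ((Finset.range N).filter fun t : ℕ => ¬ Squarefree (A * t + d)) ⊆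
      Z ∪ (Finset.Ioc B (D * s)).biUnion T := by
    intro t ht
    rw [Finset.mem_filter] at ht
    obtain ⟨htN, hsq⟩ := ht
    by_cases h0 : A * t + d = 0
    · exact Finset.mem_union_left _ (Finset.mem_filter.2 ⟨htN, h0⟩)
    · obtain ⟨p, hp, hdvd⟩ := exists_prime_sq_dvd_of_not_squarefree hsq
      refine Finset.mem_union_right _ (Finset.mem_biUnion.2 ⟨p, Finset.mem_Ioc.2 ⟨?_, ?_⟩,
        Finset.mem_filter.2 ⟨htN, hp, by exact_mod_cast hdvd⟩⟩)
      · by_contra hle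
        exact hsmall p hp (not_lt.1 hle) t hdvd
      · have h1 : p ^ 2 ≤ (A * t + d).natAbs :=
          Nat.le_of_dvd (Int.natAbs_pos.2 h0) (by
            have := Int.natAbs_dvd_natAbs.2 hdvd
            simpa [Int.natAbs_pow] using this)
        have h2 : (A * t + d).natAbs ≤ A.natAbs * t + d.natAbs := by
          refine (Int.natAbs_add_le _ _).trans ?_
          simp [Int.natAbs_mul]
        have h3 : t < s ^ 2 := Finset.mem_range.1 htN
        have h4 : 1 ≤ s ^ 2 := by omega
        have h5 : A.natAbs * t + d.natAbs ≤ D * s ^ 2 :=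
          calc A.natAbs * t + d.natAbs ≤ A.natAbs * s ^ 2 + d.natAbs * s ^ 2 :=
                Nat.add_le_add (Nat.mul_le_mul_left _ h3.le) (Nat.le_mul_of_pos_right _ h4)
            _ = (A.natAbs + d.natAbs) * s ^ 2 := (add_mul _ _ _).symm
            _ ≤ D * s ^ 2 := Nat.mul_le_mul_right _ hD
        have h6 : D ≤ D ^ 2 := Nat.le_self_pow two_ne_zero D
        have h7 : p ^ 2 ≤ (D * s) ^ 2 := by nlinarith
        exact (Nat.pow_le_pow_iff_left two_ne_zero).1 h7
  have hZ : Z.card ≤ 1 := by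
    refine Finset.card_le_one.2 fun t ht u hu => ?_
    have h1 := (Finset.mem_filter.1 ht).2
    have h2 := (Finset.mem_filter.1 hu).2
    have : A * (t : ℤ) = A * u := by linarith
    exact_mod_cast mul_left_cancel₀ hA this
  have hT : ∀ m ∈ Finset.Ioc B (D * s), ((T m).card : ℚ) ≤ N * ((m : ℚ) ^ 2)⁻¹ + 1 := by
    intro m hm
    have hBm := (Finset.mem_Ioc.1 hm).1
    by_cases hp : m.Prime
    · have h1 : (T m).card ≤ N / m ^ 2 + 1 := by
        have := card_filter_dvd_progression_le A d (m ^ 2) N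
          (by push_cast; exact (hlarge m hp hBm).pow_left)
        simpa [T, hp] using this
      have h2 : ((N / m ^ 2 : ℕ) : ℚ) ≤ (N : ℚ) / ((m ^ 2 : ℕ) : ℚ) := Nat.cast_div_le
      have h3 : ((T m).card : ℚ) ≤ ((N / m ^ 2 : ℕ) : ℚ) + 1 := by exact_mod_cast h1
      rw [← div_eq_mul_inv]
      push_cast at h2 h3 ⊢
      linarith
    · simp only [T, hp, false_and, Finset.filter_false, Finset.card_empty, Nat.cast_zero]
      positivity
  have hsum : ∑ m ∈ Finset.Ioc B (D * s), ((m : ℚ) ^ 2)⁻¹ ≤ (B : ℚ)⁻¹ := by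
    rcases le_total B (D * s) with h | h
    · refine (sum_Ioc_inv_sq_le_sub hB.ne' h).trans ?_
      have : (0 : ℚ) ≤ ((D * s : ℕ) : ℚ)⁻¹ := by positivity
      linarith
    · rw [Finset.Ioc_eq_empty_of_le h, Finset.sum_empty]
      positivity
  have hcard : (((Finset.Ioc B (D * s)).biUnion T).card : ℚ) ≤ N / B + D * s := by
    calc (((Finset.Ioc B (D * s)).biUnion T).card : ℚ)
        ≤ ∑ m ∈ Finset.Ioc B (D * s), ((T m).card : ℚ) := by
          exact_mod_cast Finset.card_biUnion_le
      _ ≤ ∑ m ∈ Finset.Ioc B (D * s), (N * ((m : ℚ) ^ 2)⁻¹ + 1) := Finset.sum_le_sum hT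
      _ = N * ∑ m ∈ Finset.Ioc B (D * s), ((m : ℚ) ^ 2)⁻¹ + ((D * s - B : ℕ) : ℚ) := by
          rw [Finset.sum_add_distrib, Finset.mul_sum]
          simp
      _ ≤ N * (B : ℚ)⁻¹ + ((D * s : ℕ) : ℚ) := by
          gcongr
          exact Nat.sub_le _ _
      _ = N / B + D * s := by push_cast; rw [div_eq_mul_inv]
  have hfin : (((Finset.range N).filter fun t : ℕ => ¬ Squarefree (A * t + d)).card : ℚ) ≤
      Z.card + ((Finset.Ioc B (D * s)).biUnion T).card := by
    exact_mod_cast (Finset.card_le_card hsub).trans (Finset.card_union_le _ _)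
  have hZ' : (Z.card : ℚ) ≤ 1 := by exact_mod_cast hZ
  have hNs : (N : ℚ) = (s : ℚ) ^ 2 := by rw [hN]; push_cast; rfl
  rw [hNs] at hcard
  linarith

/-- Finitely many progressions with common difference take simultaneously squarefree values at
arbitrarily large arguments, provided small primes are no obstruction. -/
theorem exists_ge_forall_squarefree_progression (n : ℕ) (A : ℤ) (hA : A ≠ 0) (d : Fin n → ℤ)
    (B : ℕ) (hB : 0 < B) (hnB : 2 * n ≤ B)
    (hsmall : ∀ p : ℕ, p.Prime → p ≤ B → ∀ (t : ℕ) (i : Fin n), ¬ (p : ℤ) ^ 2 ∣ A * t + d i)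
    (hlarge : ∀ p : ℕ, p.Prime → B < p → IsCoprime (p : ℤ) A) (L : ℕ) :
    ∃ t : ℕ, L ≤ t ∧ ∀ i, Squarefree (A * t + d i) := by
  classical
  by_contra! hcon
  set D := A.natAbs + ∑ i, (d i).natAbs with hD
  set s := 2 * (n + n * D + L) + 1 with hs
  let E : Fin n → Finset ℕ := fun i =>
    (Finset.range (s ^ 2)).filter fun t : ℕ => ¬ Squarefree (A * t + d i)
  have hcover : Finset.range (s ^ 2) ⊆ Finset.range L ∪ Finset.univ.biUnion E := by
    intro t ht
    rcases lt_or_ge t L with h | h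
    · exact Finset.mem_union_left _ (Finset.mem_range.2 h)
    · obtain ⟨i, hi⟩ := hcon t h
      exact Finset.mem_union_right _
        (Finset.mem_biUnion.2 ⟨i, Finset.mem_univ i, Finset.mem_filter.2 ⟨ht, hi⟩⟩)
  have hE : ∀ i ∈ (Finset.univ : Finset (Fin n)),
      ((E i).card : ℚ) ≤ 1 + ((s : ℚ) ^ 2 / B + D * s) := fun i _ =>
    card_filter_not_squarefree_le A (d i) hA B D s hB
      (fun p hp hpB t => hsmall p hp hpB t i) hlarge
      (Nat.add_le_add_left (Finset.single_le_sum (f := fun i => (d i).natAbs)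
        (fun _ _ => Nat.zero_le _) (Finset.mem_univ i)) _)
  have h1 : s ^ 2 ≤ L + ∑ i, (E i).card := by
    have := (Finset.card_le_card hcover).trans (Finset.card_union_le _ _)
    rw [Finset.card_range, Finset.card_range] at this
    exact this.trans (Nat.add_le_add_left Finset.card_biUnion_le _)
  have h2 : ((s : ℚ)) ^ 2 ≤ L + ∑ i, ((E i).card : ℚ) := by exact_mod_cast h1
  have h3 := Finset.sum_le_sum hE
  rw [Finset.sum_const, Finset.card_univ, Fintype.card_fin, nsmul_eq_mul] at h3
  have hB' : (0 : ℚ) < B := by exact_mod_cast hB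
  have h4 : (n : ℚ) * ((s : ℚ) ^ 2 / B) ≤ (s : ℚ) ^ 2 / 2 := by
    have : (2 : ℚ) * n ≤ B := by exact_mod_cast hnB
    rw [mul_div_assoc', div_le_div_iff₀ hB' two_pos]
    nlinarith [sq_nonneg (s : ℚ)]
  have h5 : (s : ℚ) = 2 * (n + n * D + L) + 1 := by rw [hs]; push_cast; rfl
  have hn0 : (0 : ℚ) ≤ n := Nat.cast_nonneg n
  have hL0 : (0 : ℚ) ≤ L := Nat.cast_nonneg L
  have hs1 : (1 : ℚ) ≤ s := by exact_mod_cast Nat.le_add_left 1 _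
  have h6 : (n : ℚ) + L ≤ (n + L) * s := le_mul_of_one_le_right (by positivity) hs1
  have h7 : (s : ℚ) * s = (2 * (n + n * D + L) + 1) * s := by rw [← h5]
  nlinarith

/-- Local solutions exist that avoid the `p ^ 2`-divisibility of all `k * b + c i` at every prime,
and force `k * b + c' j` to be divisible by the square of a prime attached to `j`. -/
theorem exists_local_solutions
    (k : ℤ) (hk : k ≠ 0) (n n' : ℕ) (c : Fin n → ℤ) (c' : Fin n' → ℤ)
    (hdist : Function.Injective (Sum.elim c c'))
    (hloc : ∀ p : ℕ, p.Prime → ∃ a : ℤ, ∀ i : Fin n, ¬ ((p : ℤ) ^ 2 ∣ k * a + c i)) :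
    ∃ (q : Fin n' → ℕ) (b : ℕ → ℤ), (∀ j, (q j).Prime) ∧
      (∀ p : ℕ, p.Prime → ∀ i, ¬ (p : ℤ) ^ 2 ∣ k * b p + c i) ∧
      ∀ j, (q j : ℤ) ^ 2 ∣ k * b (q j) + c' j := by
  set Q := k.natAbs + ∑ i, ∑ j, (c i - c' j).natAbs with hQ
  let q : Fin n' → ℕ := fun j => Nat.nth Nat.Prime (Q + j)
  have hqp : ∀ j, (q j).Prime := fun j => Nat.prime_nth_prime _
  have hqQ : ∀ j, Q < q j := fun j => by
    have := Nat.add_two_le_nth_prime (Q + j)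
    simp only [q]
    omega
  have hqinj : Function.Injective q := fun i j h => by
    have := Nat.nth_injective Nat.infinite_setOfPred_prime h
    exact Fin.ext (by omega)
  have key : ∀ p : ℕ, ∃ b : ℤ, p.Prime →
      (∀ i, ¬ (p : ℤ) ^ 2 ∣ k * b + c i) ∧ ∀ j, q j = p → (p : ℤ) ^ 2 ∣ k * b + c' j := by
    intro p
    by_cases hj : ∃ j, q j = p
    · obtain ⟨j, rfl⟩ := hj
      have hcop : IsCoprime ((q j : ℤ) ^ 2) k := by
        refine IsCoprime.pow_left ?_
        rw [(Nat.prime_iff_prime_int.1 (hqp j)).coprime_iff_not_dvd]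
        intro h
        have := Nat.le_of_dvd (Int.natAbs_pos.2 hk) (Int.natCast_dvd.1 h)
        have := hqQ j
        omega
      obtain ⟨u, v, huv⟩ := hcop
      have hdvd : (q j : ℤ) ^ 2 ∣ k * (-(c' j) * v) + c' j :=
        ⟨c' j * u, by linear_combination (-(c' j)) * huv⟩
      refine ⟨-(c' j) * v, fun _ => ⟨fun i hi => ?_, fun j' h => hqinj h ▸ hdvd⟩⟩
      have h1 : (q j : ℤ) ^ 2 ∣ c i - c' j := by
        have := dvd_sub hi hdvd
        rwa [add_sub_add_left_eq_sub] at this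
      have hne : c i - c' j ≠ 0 := fun h0 => by
        have := @hdist (Sum.inl i) (Sum.inr j) (sub_eq_zero.1 h0)
        simp at this
      have h2 : (q j) ^ 2 ≤ (c i - c' j).natAbs :=
        Nat.le_of_dvd (Int.natAbs_pos.2 hne) (Int.natCast_dvd.1 (by exact_mod_cast h1))
      have h3 : (c i - c' j).natAbs ≤ ∑ j, (c i - c' j).natAbs :=
        Finset.single_le_sum (f := fun j => (c i - c' j).natAbs)
          (fun _ _ => Nat.zero_le _) (Finset.mem_univ j)
      have h4 : ∑ j, (c i - c' j).natAbs ≤ ∑ i, ∑ j, (c i - c' j).natAbs :=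
        Finset.single_le_sum (f := fun i => ∑ j, (c i - c' j).natAbs)
          (fun _ _ => Nat.zero_le _) (Finset.mem_univ i)
      have h5 := Nat.le_self_pow two_ne_zero (q j)
      have := hqQ j
      omega
    · by_cases hp : p.Prime
      · obtain ⟨a, ha⟩ := hloc p hp
        exact ⟨a, fun _ => ⟨ha, fun j h => (hj ⟨j, h⟩).elim⟩⟩
      · exact ⟨0, fun h => (hp h).elim⟩
  choose b hb using key
  exact ⟨q, b, hqp, fun p hp => (hb p hp).1, fun j => (hb (q j) (hqp j)).2 j rfl⟩

/-- Chinese remainder theorem for the squares of the primes in a finite set. -/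
theorem exists_forall_prime_sq_dvd_sub (S : Finset ℕ) (hS : ∀ p ∈ S, p.Prime) (b : ℕ → ℤ) :
    ∃ r : ℤ, ∀ p ∈ S, (p : ℤ) ^ 2 ∣ r - b p := by
  obtain ⟨r, hr⟩ := Nat.chineseRemainderOfFinset (fun p => (b p % (p : ℤ) ^ 2).toNat)
    (fun p => p ^ 2) S (fun p hp => pow_ne_zero 2 (hS p hp).ne_zero)
    (fun p hp p' hp' hne =>
      Nat.Coprime.pow 2 2 ((Nat.coprime_primes (hS p hp) (hS p' hp')).2 hne))
  refine ⟨r, fun p hp => ?_⟩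
  have hp0 : (p : ℤ) ^ 2 ≠ 0 := pow_ne_zero 2 (by exact_mod_cast (hS p hp).ne_zero)
  have h1 := Nat.modEq_iff_dvd.1 (hr p hp).symm
  push_cast at h1
  rw [Int.toNat_of_nonneg (Int.emod_nonneg _ hp0)] at h1
  have h2 : (p : ℤ) ^ 2 ∣ b p % (p : ℤ) ^ 2 - b p :=
    (Int.mod_modEq (b p) ((p : ℤ) ^ 2)).symm.dvd
  simpa using dvd_add h1 h2

/-- Genericity for `(ℤ; Sqf)`: if `k ≠ 0`, the integers `c i`, `c' j` are pairwise
distinct, and for every prime `p` there is `a_p` with `p² ∤ k * a_p + c i` for all `i`,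
then there are infinitely many integers `a` with every `k * a + c i` squarefree and
every `k * a + c' j` not squarefree. -/
theorem int_system_infinitely_satisfiable
    (k : ℤ) (hk : k ≠ 0) (n n' : ℕ) (c : Fin n → ℤ) (c' : Fin n' → ℤ)
    (hdist : Function.Injective (Sum.elim c c'))
    (hloc : ∀ p : ℕ, p.Prime → ∃ a : ℤ, ∀ i : Fin n, ¬ ((p : ℤ) ^ 2 ∣ k * a + c i)) :
    {a : ℤ | (∀ i : Fin n, Squarefree (k * a + c i)) ∧
      (∀ j : Fin n', ¬ Squarefree (k * a + c' j))}.Infinite := by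
  obtain ⟨q, b, hq, hb, hbq⟩ := exists_local_solutions k hk n n' c c' hdist hloc
  set B := 2 * n + 1 + k.natAbs + ∑ j, q j with hB
  have hqB : ∀ j, q j ≤ B := fun j => by
    have := Finset.single_le_sum (f := q) (fun _ _ => Nat.zero_le _) (Finset.mem_univ j)
    omega
  set S := (Finset.range (B + 1)).filter Nat.Prime with hS
  have hmem : ∀ p : ℕ, p.Prime → p ≤ B → p ∈ S := fun p hp hpB =>
    Finset.mem_filter.2 ⟨Finset.mem_range.2 (Nat.lt_succ_of_le hpB), hp⟩
  have hSp : ∀ p ∈ S, p.Prime := fun p hp => (Finset.mem_filter.1 hp).2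
  obtain ⟨r, hr⟩ := exists_forall_prime_sq_dvd_sub S hSp b
  set M : ℤ := ∏ p ∈ S, (p : ℤ) ^ 2 with hM
  have hMpos : 0 < M := Finset.prod_pos fun p hp =>
    pow_pos (by exact_mod_cast (hSp p hp).pos) 2
  have hcongr : ∀ p : ℕ, p.Prime → p ≤ B → ∀ (t e : ℤ),
      ((p : ℤ) ^ 2 ∣ k * (r + M * t) + e ↔ (p : ℤ) ^ 2 ∣ k * b p + e) := by
    intro p hp hpB t e
    have h1 : (p : ℤ) ^ 2 ∣ M := Finset.dvd_prod_of_mem (fun p : ℕ => (p : ℤ) ^ 2) (hmem p hp hpB)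
    have h2 : (p : ℤ) ^ 2 ∣ k * (r - b p) + k * t * M :=
      dvd_add ((hr p (hmem p hp hpB)).mul_left k) (h1.mul_left _)
    rw [show k * (r + M * t) + e = (k * (r - b p) + k * t * M) + (k * b p + e) by ring]
    exact dvd_add_right h2
  have hform : ∀ (t e : ℤ), k * M * t + (k * r + e) = k * (r + M * t) + e := fun t e => by ring
  refine Set.infinite_of_forall_exists_gt fun x => ?_
  obtain ⟨t, htL, ht⟩ := exists_ge_forall_squarefree_progression n (k * M)
    (mul_ne_zero hk hMpos.ne') (fun i => k * r + c i) B (by omega) (by omega)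
    (fun p hp hpB t i => by
      rw [hform, hcongr p hp hpB]
      exact hb p hp i)
    (fun p hp hpB => by
      refine IsCoprime.mul_right ?_ (IsCoprime.prod_right fun p' hp' => IsCoprime.pow_right ?_)
      · rw [(Nat.prime_iff_prime_int.1 hp).coprime_iff_not_dvd]
        intro h
        have := Nat.le_of_dvd (Int.natAbs_pos.2 hk) (Int.natCast_dvd.1 h)
        omega
      · have h1 := Finset.mem_range.1 (Finset.mem_filter.1 hp').1
        exact Nat.isCoprime_iff_coprime.2 ((Nat.coprime_primes hp (hSp p' hp')).2 (by omega)))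
    ((x - r).toNat + 1)
  refine ⟨r + M * t, ⟨fun i => ?_, fun j hsq => ?_⟩, ?_⟩
  · rw [← hform]
    exact ht i
  · have h1 := (hcongr (q j) (hq j) (hqB j) t (c' j)).2 (hbq j)
    rw [pow_two] at h1
    exact (Nat.prime_iff_prime_int.1 (hq j)).not_isUnit (hsq _ h1)
  · have h1 : (t : ℤ) ≤ M * t := le_mul_of_one_le_left (Int.natCast_nonneg t) hMpos
    omega
end

section
/- Let p be a prime and let a be a nonzero rational number with v_p(a) < 0. Then there exists a rational number ε with v_p(ε) ≥ 0 (allowing ε = 0) such that a + ε is a squarefree rational number. -/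
/-- A rational number is squarefree if it is nonzero and its `p`-adic valuation is
at most `1` for every prime `p`. -/
def SquarefreeRat (a : ℚ) : Prop :=
  a ≠ 0 ∧ ∀ p : ℕ, p.Prime → padicValRat p a ≤ 1

/-- The inverse of a nonzero integer is a squarefree rational. -/
theorem squarefreeRat_inv_intCast {n : ℤ} (hn : n ≠ 0) : SquarefreeRat ((n : ℚ)⁻¹) := by
  refine ⟨inv_ne_zero (Int.cast_ne_zero.2 hn), fun q hq => ?_⟩
  have := Fact.mk hq
  rw [padicValRat.inv, padicValRat.of_int]
  omega

/-- If `a` is a nonzero rational with `v_p(a) < 0`, there is a rational `ε` with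
`v_p(ε) ≥ 0` (allowing `ε = 0`) such that `a + ε` is a squarefree rational. -/
theorem exists_padic_integral_perturbation_squarefree
    (p : ℕ) (hp : p.Prime) (a : ℚ) (ha : a ≠ 0) (hv : padicValRat p a < 0) :
    ∃ ε : ℚ, (ε = 0 ∨ 0 ≤ padicValRat p ε) ∧ SquarefreeRat (a + ε) := by
  have := Fact.mk hp
  have hpden : p ∣ a.den := by
    by_contra h
    rw [padicValRat_def, padicValNat.eq_zero_of_not_dvd h] at hv
    omega
  obtain ⟨n, m, hm, hden⟩ := Nat.exists_eq_pow_mul_and_not_dvd a.den_nz p hp.ne_one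
  have hn : n ≠ 0 := by
    rintro rfl
    rw [pow_zero, one_mul] at hden
    exact hm (hden ▸ hpden)
  have hcop : IsCoprime a.num ((p : ℤ) ^ n) := by
    have h : IsCoprime a.num (a.den : ℤ) := Rat.isCoprime_num_den a
    rw [hden] at h
    push_cast at h
    exact h.of_mul_right_left
  obtain ⟨x, y, hxy⟩ := hcop
  -- `d` is congruent to `m / a.num` modulo `p ^ n`.
  set d : ℤ := m * x
  have hd : (m : ℤ) - d * a.num = p ^ n * (m * y) := by linear_combination (-(m : ℤ)) * hxy
  have hpm : ¬ (p : ℤ) ∣ m := mt Int.natCast_dvd_natCast.1 hm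
  have hpd : ¬ (p : ℤ) ∣ d := fun h => hpm <| by
    have h' : (p : ℤ) ∣ p ^ n * (m * y) := (dvd_pow_self _ hn).mul_right _
    rw [← hd] at h'
    exact (dvd_sub_left (h.mul_right _)).1 h'
  have hd0 : d ≠ 0 := fun h => hpd (h ▸ dvd_zero _)
  have hm0 : m ≠ 0 := fun h => hm (h ▸ dvd_zero _)
  have hdQ : (d : ℚ) ≠ 0 := Int.cast_ne_zero.2 hd0
  have hmQ : (m : ℚ) ≠ 0 := Nat.cast_ne_zero.2 hm0
  have hpQ : (p : ℚ) ≠ 0 := Nat.cast_ne_zero.2 hp.ne_zero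
  have hpnd : (p : ℤ) ^ n * d ≠ 0 := mul_ne_zero (pow_ne_zero _ (mod_cast hp.ne_zero)) hd0
  refine ⟨(y : ℚ) / d, ?_, ?_⟩
  · rcases eq_or_ne y 0 with rfl | hy
    · simp
    · right
      rw [padicValRat.div (Int.cast_ne_zero.2 hy) hdQ, padicValRat.of_int, padicValRat.of_int,
        padicValInt.eq_zero_of_not_dvd hpd]
      omega
  · convert squarefreeRat_inv_intCast hpnd using 1
    have hdQ' : (m : ℚ) - d * a.num = p ^ n * (m * y) := mod_cast hd
    conv_lhs => rw [← Rat.num_div_den a, hden]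
    push_cast
    field_simp
    linear_combination -hdQ'
end

section
/- Let p be a prime and let a be a rational number with v_p(a) ≥ 0 (with a = 0 allowed). Then there exist nonzero squarefree rational numbers a_1 and a_2 with v_p(a_1) ≥ 0 and v_p(a_2) ≥ 0 such that a = a_1 + a_2. -/
theorem ne_zero_of_not_dvd {α : Type*} [SemigroupWithZero α] {a b : α} (h : ¬ a ∣ b) : b ≠ 0 :=
  fun hb => h (hb ▸ dvd_zero a)

theorem padicValRat_natCast_div_intCast {q : ℕ} (hq : q.Prime) {u : ℕ} {k : ℤ} (hu : u ≠ 0)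
    (hk : k ≠ 0) :
    padicValRat q ((u : ℚ) / k) = padicValNat q u - padicValInt q k := by
  have : Fact q.Prime := ⟨hq⟩
  rw [padicValRat.div (by exact_mod_cast hu) (by exact_mod_cast hk), padicValRat.of_nat,
    padicValRat.of_int]

theorem Squarefree.squarefreeRat_div {u : ℕ} (hu : Squarefree u) {k : ℤ} (hk : k ≠ 0) :
    SquarefreeRat ((u : ℚ) / k) := by
  refine ⟨div_ne_zero (by exact_mod_cast hu.ne_zero) (by exact_mod_cast hk), fun q hq => ?_⟩
  rw [padicValRat_natCast_div_intCast hq hu.ne_zero hk]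
  have h := hu.natFactorization_le_one q
  rw [Nat.factorization_def _ hq] at h
  omega

theorem padicValRat_natCast_div_intCast_nonneg {q : ℕ} (hq : q.Prime) {u : ℕ} {k : ℤ}
    (hu : u ≠ 0) (hk : ¬ (q : ℤ) ∣ k) : 0 ≤ padicValRat q ((u : ℚ) / k) := by
  rw [padicValRat_natCast_div_intCast hq hu (ne_zero_of_not_dvd hk), padicValInt.eq_zero_of_not_dvd hk]
  omega

theorem exists_prime_gt_and_eq_add_mul {a n : ℤ} (hn : n ≠ 0) (h : IsCoprime a n) (N : ℕ) :
    ∃ v : ℕ, N < v ∧ v.Prime ∧ ∃ k : ℤ, (v : ℤ) = a + n * k := by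
  have h' : IsCoprime a (n.natAbs : ℤ) := by
    rw [Int.natCast_natAbs]
    exact h.abs_right
  obtain ⟨v, hv, hvp, hmod⟩ :=
    Nat.forall_exists_prime_gt_and_zmodEq N (Int.natAbs_ne_zero.mpr hn) h'
  obtain ⟨k, hk⟩ := Int.natAbs_dvd.mp hmod.symm.dvd
  exact ⟨v, hv, hvp, k, by omega⟩

theorem exists_squarefree_add_eq_mul {p : ℕ} (hp : p.Prime) {n d : ℤ} (hn : n ≠ 0)
    (hnd : IsCoprime n d) :
    ∃ u v : ℕ, Squarefree u ∧ Squarefree v ∧ ∃ m : ℤ, ¬ (p : ℤ) ∣ m ∧ d * u + v = n * m := by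
  have hpI : Prime (p : ℤ) := Nat.prime_iff_prime_int.mp hp
  by_cases hpn : (p : ℤ) ∣ n
  · have hcop : IsCoprime (n - d) n := by
      simpa [sub_eq_neg_add] using hnd.symm.neg_left.add_mul_left_left 1
    obtain ⟨v, -, hv, k, hk⟩ := exists_prime_gt_and_eq_add_mul
      (mul_ne_zero hn hpI.ne_zero) (hcop.mul_right (hcop.of_isCoprime_of_dvd_right hpn)) 0
    refine ⟨1, v, squarefree_one, hv.prime.squarefree, 1 + p * k, fun h => ?_, ?_⟩
    · exact hpI.not_dvd_one ((dvd_add_left (dvd_mul_right _ _)).mp h)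
    · rw [hk]
      push_cast
      ring
  · have hcop : IsCoprime (-(d * p)) n :=
      (hnd.symm.mul_left ((Prime.coprime_iff_not_dvd hpI).mpr hpn)).neg_left
    obtain ⟨v, hpv, hv, m, hm⟩ := exists_prime_gt_and_eq_add_mul hn hcop p
    refine ⟨p, v, hp.prime.squarefree, hv.prime.squarefree, m, fun h => ?_, by rw [hm]; ring⟩
    have hdvd : (p : ℤ) ∣ v := by
      rw [hm]
      exact dvd_add (dvd_neg.mpr (dvd_mul_left _ _)) (h.mul_left _)
    exact hpv.ne ((Nat.prime_dvd_prime_iff_eq hp hv).mp (Int.natCast_dvd_natCast.mp hdvd))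

theorem not_dvd_den_of_padicValRat_nonneg {p : ℕ} (hp : p.Prime) {a : ℚ}
    (h : 0 ≤ padicValRat p a) : ¬ p ∣ a.den := by
  have : Fact p.Prime := ⟨hp⟩
  intro hd
  have hnum : ¬ (p : ℤ) ∣ a.num := fun hn =>
    Nat.not_coprime_of_dvd_of_dvd hp.one_lt (Int.natCast_dvd.mp hn) hd a.reduced
  have hpos := one_le_padicValNat_of_dvd a.den_nz hd
  rw [padicValRat, padicValInt.eq_zero_of_not_dvd hnum] at h
  omega

/-- Every rational `a` with `v_p(a) ≥ 0` (with `a = 0` allowed) is a sum of two nonzero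
squarefree rationals `a₁`, `a₂` with `v_p(a₁) ≥ 0` and `v_p(a₂) ≥ 0`. -/
theorem sum_of_two_squarefree_rat_padic_integral
    (p : ℕ) (hp : p.Prime) (a : ℚ) (hv : a = 0 ∨ 0 ≤ padicValRat p a) :
    ∃ a₁ a₂ : ℚ, SquarefreeRat a₁ ∧ SquarefreeRat a₂ ∧
      0 ≤ padicValRat p a₁ ∧ 0 ≤ padicValRat p a₂ ∧ a = a₁ + a₂ := by
  have hpI : Prime (p : ℤ) := Nat.prime_iff_prime_int.mp hp
  suffices ∃ u v : ℕ, Squarefree u ∧ Squarefree v ∧ ∃ k l : ℤ, ¬ (p : ℤ) ∣ k ∧ ¬ (p : ℤ) ∣ l ∧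
      a = (u : ℚ) / k + (v : ℚ) / l by
    obtain ⟨u, v, hu, hv, k, l, hk, hl, h⟩ := this
    exact ⟨_, _, hu.squarefreeRat_div (ne_zero_of_not_dvd hk),
      hv.squarefreeRat_div (ne_zero_of_not_dvd hl),
      padicValRat_natCast_div_intCast_nonneg hp hu.ne_zero hk,
      padicValRat_natCast_div_intCast_nonneg hp hv.ne_zero hl, h⟩
  by_cases ha : a = 0
  · exact ⟨1, 1, squarefree_one, squarefree_one, 1, -1, hpI.not_dvd_one,
      fun h => hpI.not_dvd_one (dvd_neg.mp h), by simp [ha]⟩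
  have hden : ¬ (p : ℤ) ∣ a.den := fun h =>
    not_dvd_den_of_padicValRat_nonneg hp (hv.resolve_left ha) (Int.natCast_dvd_natCast.mp h)
  obtain ⟨u, v, hu, hv, m, hm, h⟩ := exists_squarefree_add_eq_mul hp (Rat.num_ne_zero.mpr ha)
    (Rat.isCoprime_num_den a)
  refine ⟨u, v, hu, hv, m, a.den * m, hm, hpI.not_dvd_mul hden hm, ?_⟩
  have hm0 : (m : ℚ) ≠ 0 := Int.cast_ne_zero.mpr (ne_zero_of_not_dvd hm)
  have hd0 : (a.den : ℚ) ≠ 0 := by exact_mod_cast a.den_nz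
  have hQ : (a.den : ℚ) * u + v = a.num * m := by exact_mod_cast h
  nth_rw 1 [← Rat.num_div_den a]
  push_cast
  field_simp
  linarith
end

section
/- Let p be a prime and let a be a nonzero rational number that is not squarefree. Then v_p(a) < 0 if and only if there exists a rational number ε with v_p(ε) ≥ 0 such that a + ε is a squarefree rational number and v_p(a + ε) < 0. -/
theorem padicValRat_inv_intCast_nonpos (q : ℕ) [Fact q.Prime] (z : ℤ) :
    padicValRat q (z : ℚ)⁻¹ ≤ 0 := by
  rw [padicValRat.inv, padicValRat.of_int]
  omega

theorem squarefreeRat_inv_intCast_s9 {z : ℤ} (hz : z ≠ 0) : SquarefreeRat (z : ℚ)⁻¹ :=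
  ⟨inv_ne_zero (Int.cast_ne_zero.mpr hz),
    fun q hq => haveI := Fact.mk hq; (padicValRat_inv_intCast_nonpos q z).trans zero_le_one⟩

theorem dvd_den_of_padicValRat_neg {p : ℕ} {a : ℚ} (h : padicValRat p a < 0) : p ∣ a.den := by
  by_contra hd
  have h0 := padicValNat.eq_zero_of_not_dvd hd
  rw [padicValRat_def, h0] at h
  omega

theorem padicValRat_add_nonneg {p : ℕ} [Fact p.Prime] {a b : ℚ} (ha : 0 ≤ padicValRat p a)
    (hb : 0 ≤ padicValRat p b) : 0 ≤ padicValRat p (a + b) := by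
  by_cases hab : a + b = 0
  · simp [hab]
  · exact (le_min ha hb).trans (padicValRat.min_le_padicValRat_add hab)

/-- For a prime `p` and a nonzero non-squarefree rational `a`: `v_p(a) < 0` if and only
if there is a rational `ε` with `v_p(ε) ≥ 0` such that `a + ε` is squarefree and
`v_p(a + ε) < 0`. -/
theorem padicValRat_neg_iff_perturbation
    (p : ℕ) (hp : p.Prime) (a : ℚ) (ha : a ≠ 0) (hnsf : ¬ SquarefreeRat a) :
    padicValRat p a < 0 ↔
      ∃ ε : ℚ, 0 ≤ padicValRat p ε ∧ SquarefreeRat (a + ε) ∧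
        padicValRat p (a + ε) < 0 := by
  have : Fact p.Prime := ⟨hp⟩
  constructor
  · intro h
    have hpd : (p : ℤ) ∣ a.den := Int.natCast_dvd_natCast.mpr (dvd_den_of_padicValRat_neg h)
    obtain ⟨u, v, huv⟩ : IsCoprime a.num (a.den : ℤ) := Rat.isCoprime_num_den a
    have hpu : ¬ (p : ℤ) ∣ u := fun hu =>
      (Nat.prime_iff_prime_int.mp hp).not_dvd_one
        (huv ▸ dvd_add (hu.mul_right _) (hpd.mul_left _))
    have hu : u ≠ 0 := by
      rintro rfl
      exact hpu (dvd_zero _)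
    have hden : (a.den : ℚ) ≠ 0 := by exact_mod_cast a.den_nz
    have hε : 0 ≤ padicValRat p ((v : ℚ) / u) := by
      by_cases hv : v = 0
      · simp [hv]
      · rw [padicValRat.div (by exact_mod_cast hv) (by exact_mod_cast hu), padicValRat.of_int,
          padicValRat.of_int, padicValInt.eq_zero_of_not_dvd hpu]
        omega
    have hsum : a + (v : ℚ) / u = (((a.den : ℤ) * u : ℤ) : ℚ)⁻¹ := by
      have huQ : (u : ℚ) ≠ 0 := by exact_mod_cast hu
      have huvQ : (u : ℚ) * a.num + v * a.den = 1 := by exact_mod_cast huv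
      have hnum : a * a.den = a.num := Rat.mul_den_eq_num a
      push_cast
      field_simp
      linear_combination huvQ + u * hnum
    refine ⟨v / u, hε, hsum ▸ squarefreeRat_inv_intCast_s9
      (mul_ne_zero (by exact_mod_cast a.den_nz) hu), ?_⟩
    by_contra! hn
    refine h.not_ge ?_
    have hneg : 0 ≤ padicValRat p (-((v : ℚ) / u)) := by rwa [padicValRat.neg]
    simpa using padicValRat_add_nonneg hn hneg
  · rintro ⟨ε, hε, -, hneg⟩
    by_contra! hn
    exact hneg.not_ge (padicValRat_add_nonneg hn hε)
end

section
/- Let c_1 < c_2 < … < c_n be natural numbers and assume that for every prime p there exists an integer x such that p² does not divide x + c_i for every i ∈ {1, …, n}. Then there exists a natural number a such that a + c_i is squarefree for every i ∈ {1, …, n} and every squarefree integer b with a + c_1 ≤ b ≤ a + c_n is equal to a + c_i for some i ∈ {1, …, n} (that is, a + c_1, …, a + c_n are consecutive squarefree integers). -/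
/-- An arithmetic progression whose difference is coprime to `m` meets the multiples of `m` at most
`T / m + 1` times among its first `T` terms. -/
lemma card_filter_dvd_add_mul_le {m Q : ℕ} (hm : 0 < m) (h : Nat.Coprime m Q) (b T : ℕ) :
    ((Finset.range T).filter (fun t => m ∣ b + Q * t)).card ≤ T / m + 1 := by
  rcases ((Finset.range T).filter (fun t => m ∣ b + Q * t)).eq_empty_or_nonempty with he | ⟨u, hu⟩
  · simp [he]
  · rw [Finset.mem_filter] at hu
    have hsub : (Finset.range T).filter (fun t => m ∣ b + Q * t) ⊆
        (Finset.range T).filter (fun t => t ≡ u [MOD m]) := by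
      intro t ht
      rw [Finset.mem_filter] at ht ⊢
      refine ⟨ht.1, ?_⟩
      have h1 : b + Q * t ≡ b + Q * u [MOD m] :=
        ((Nat.modEq_zero_iff_dvd).2 ht.2).trans ((Nat.modEq_zero_iff_dvd).2 hu.2).symm
      exact Nat.ModEq.cancel_left_of_coprime h (Nat.ModEq.add_left_cancel' b h1)
    refine (Finset.card_le_card hsub).trans ?_
    rw [← Nat.count_eq_card_filter_range, Nat.count_modEq_card _ hm]
    split_ifs <;> omega

/-- If no prime `p ≤ P` obstructs, and `P` is large compared with the number of shifts, then
an arithmetic progression whose difference is coprime to all primes exceeding `P` contains a term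
all of whose shifts are squarefree. -/
lemma exists_forall_squarefree_add_mul {n P Q b : ℕ} (c : Fin n → ℕ) (hP : 0 < P)
    (hn : 2 * n ≤ P)
    (hQ : ∀ p : ℕ, p.Prime → P < p → Nat.Coprime p Q)
    (hb : ∀ p : ℕ, p.Prime → p ≤ P → ∀ (i : Fin n) (t : ℕ), ¬ p ^ 2 ∣ b + c i + Q * t) :
    ∃ t : ℕ, ∀ i, Squarefree (b + c i + Q * t) := by
  by_contra! hcon
  obtain ⟨C, hC⟩ : ∃ C, ∀ i, c i ≤ C :=
    ⟨∑ i, c i, fun i => Finset.single_le_sum (fun _ _ => Nat.zero_le _) (Finset.mem_univ i)⟩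
  set S := b + C + Q + 1 with hS
  set k := 2 * n + 1 + P with hk
  set T := S * k ^ 2 with hT
  set R := S * k with hR
  have hkpos : 0 < k := by omega
  have hSpos : 0 < S := by omega
  have hTpos : 0 < T := by positivity
  have hbnd : ∀ i, ∀ t < T, b + c i + Q * t ≤ R ^ 2 := by
    intro i t ht
    have h1 : R ^ 2 = S * T := by rw [hR, hT]; ring
    have h2 := hC i
    have h3 : Q * t ≤ Q * T := Nat.mul_le_mul_left _ ht.le
    rw [h1, hS]
    nlinarith
  have hcover : Finset.range T ⊆ (Finset.univ : Finset (Fin n)).biUnion fun i =>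
      ((Finset.Ioc P R).filter Nat.Prime).biUnion fun p =>
        (Finset.range T).filter (fun t => p ^ 2 ∣ b + c i + Q * t) := by
    intro t ht
    obtain ⟨i, hi⟩ := hcon t
    rw [Nat.squarefree_iff_prime_squarefree] at hi
    push Not at hi
    obtain ⟨p, hp, hpd⟩ := hi
    rw [← sq] at hpd
    have hPp : P < p := by
      by_contra hle
      exact hb p hp (not_lt.1 hle) i t hpd
    have hpos : 0 < b + c i + Q * t := by
      by_contra h0
      exact hb 2 Nat.prime_two (by have := i.pos; omega) i t (by
        rw [Nat.eq_zero_of_not_pos h0]; exact dvd_zero _)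
    have hpR : p ≤ R := (Nat.pow_le_pow_iff_left two_ne_zero).1
      ((Nat.le_of_dvd hpos hpd).trans (hbnd i t (Finset.mem_range.1 ht)))
    simp only [Finset.mem_biUnion, Finset.mem_filter, Finset.mem_univ, true_and, Finset.mem_Ioc]
    exact ⟨i, p, ⟨⟨hPp, hpR⟩, hp⟩, ht, hpd⟩
  have hPR : P ≤ R := by rw [hR]; nlinarith
  have hinner : ∀ i : Fin n, ((((Finset.Ioc P R).filter Nat.Prime).biUnion fun p =>
      (Finset.range T).filter (fun t => p ^ 2 ∣ b + c i + Q * t)).card : ℚ) ≤ T / P + R := by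
    intro i
    calc _ ≤ ((∑ p ∈ (Finset.Ioc P R).filter Nat.Prime, (T / p ^ 2 + 1) : ℕ) : ℚ) := by
          refine Nat.cast_le.2 (Finset.card_biUnion_le.trans (Finset.sum_le_sum fun p hp => ?_))
          rw [Finset.mem_filter, Finset.mem_Ioc] at hp
          exact card_filter_dvd_add_mul_le (pow_pos hp.2.pos 2)
            (Nat.Coprime.pow_left 2 (hQ p hp.2 hp.1.1)) _ _
      _ ≤ ((∑ p ∈ Finset.Ioc P R, (T / p ^ 2 + 1) : ℕ) : ℚ) :=
          Nat.cast_le.2 (Finset.sum_le_sum_of_subset (Finset.filter_subset _ _))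
      _ ≤ ∑ p ∈ Finset.Ioc P R, ((T : ℚ) * ((p : ℚ) ^ 2)⁻¹ + 1) := by
          rw [Nat.cast_sum]
          refine Finset.sum_le_sum fun p _ => ?_
          have h := @Nat.cast_div_le ℚ _ _ _ T (p ^ 2)
          rw [div_eq_mul_inv] at h
          push_cast at h ⊢
          linarith
      _ = (T : ℚ) * ∑ p ∈ Finset.Ioc P R, ((p : ℚ) ^ 2)⁻¹ + ((R - P : ℕ) : ℚ) := by
          rw [Finset.sum_add_distrib, Finset.mul_sum]
          simp
      _ ≤ T * (P : ℚ)⁻¹ + R := by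
          have h1 : ∑ p ∈ Finset.Ioc P R, ((p : ℚ) ^ 2)⁻¹ ≤ (P : ℚ)⁻¹ :=
            (sum_Ioc_inv_sq_le_sub hP.ne' hPR).trans (sub_le_self _ (by positivity))
          have h2 : ((R - P : ℕ) : ℚ) ≤ R := Nat.cast_le.2 (Nat.sub_le _ _)
          gcongr
      _ = T / P + R := by rw [div_eq_mul_inv]
  have htotal : (T : ℚ) ≤ n * (T / P + R) := by
    have h1 := (Finset.card_le_card hcover).trans Finset.card_biUnion_le
    rw [Finset.card_range] at h1
    calc (T : ℚ) ≤ _ := Nat.cast_le.2 h1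
      _ ≤ ∑ _i : Fin n, ((T : ℚ) / P + R) := by
          rw [Nat.cast_sum]
          exact Finset.sum_le_sum fun i _ => hinner i
      _ = _ := by simp [mul_add]
  have hP0 : (0 : ℚ) < P := Nat.cast_pos.2 hP
  have hhalf : (n : ℚ) * (T / P) ≤ T / 2 := by
    have h2 : (2 * n : ℚ) ≤ P := by exact_mod_cast hn
    rw [← mul_div_assoc, div_le_div_iff₀ hP0 two_pos]
    nlinarith [Nat.cast_nonneg (α := ℚ) T]
  have hfin : T ≤ 2 * n * R := by
    have : (T : ℚ) ≤ 2 * n * R := by linarith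
    exact_mod_cast this
  have h3 : T = k * R := by rw [hT, hR]; ring
  have hRpos : 0 < R := by positivity
  rw [h3] at hfin
  have := Nat.le_of_mul_le_mul_right hfin hRpos
  omega

/-- A residue that avoids all `-c i` modulo `p ^ 2`, and hits `-d` modulo `p ^ 2` when `p` is the
prime attached to a number `d` outside the range of `c`. -/
lemma exists_residue_of_prime {ι : Type*} {P p : ℕ} (c : ι → ℕ) (hp : p.Prime)
    (hc : ∀ i, c i ≤ P)
    (hloc : ∃ x : ℤ, ∀ i, ¬ ((p : ℤ) ^ 2 ∣ x + (c i : ℤ))) :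
    ∃ x : ℕ, (∀ i, ¬ p ^ 2 ∣ x + c i) ∧
      ∀ d, d ∉ Set.range c → p = Nat.nth Nat.Prime (P + d) → p ^ 2 ∣ x + d := by
  by_cases h : ∃ d, d ∉ Set.range c ∧ p = Nat.nth Nat.Prime (P + d)
  · obtain ⟨d, hd, hpd⟩ := h
    have hlarge : P + d + 2 ≤ p := hpd ▸ Nat.add_two_le_nth_prime (P + d)
    have hpp : p ≤ p ^ 2 := Nat.le_self_pow two_ne_zero p
    refine ⟨p ^ 2 - d, fun i hi => hd ⟨i, ?_⟩, fun e _ he => ?_⟩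
    · have hci := hc i
      have h1 : ((p ^ 2 : ℕ) : ℤ) ∣ (c i : ℤ) - d := by
        have h2 : ((p ^ 2 : ℕ) : ℤ) ∣ ((p ^ 2 - d + c i : ℕ) : ℤ) := Int.natCast_dvd_natCast.2 hi
        have h3 : ((p ^ 2 - d + c i : ℕ) : ℤ) = ((p ^ 2 : ℕ) : ℤ) + ((c i : ℤ) - d) := by omega
        rw [h3] at h2
        exact (Int.dvd_add_right (dvd_refl _)).1 h2
      have h4 := Int.eq_zero_of_abs_lt_dvd h1 (by rw [abs_lt]; constructor <;> omega)
      omega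
    · have : e = d := by
        have := Nat.nth_injective Nat.infinite_setOfPred_prime (hpd.symm.trans he)
        omega
      subst this
      rw [Nat.sub_add_cancel (by omega)]
  · push Not at h
    obtain ⟨x, hx⟩ := hloc
    have hp2 : (0 : ℤ) < (p : ℤ) ^ 2 := by have := hp.pos; positivity
    refine ⟨(x % (p : ℤ) ^ 2).toNat, fun i hi => hx i ?_, fun d hd hpd => absurd hpd (h d hd)⟩
    have h1 := Int.natCast_dvd_natCast.2 hi
    push_cast at h1
    rw [Int.toNat_of_nonneg (Int.emod_nonneg _ hp2.ne')] at h1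
    have h2 : x + (c i : ℤ) = x % (p : ℤ) ^ 2 + c i + (p : ℤ) ^ 2 * (x / (p : ℤ) ^ 2) := by
      have := Int.emod_add_mul_ediv x ((p : ℤ) ^ 2)
      linarith
    rw [h2]
    exact dvd_add h1 (dvd_mul_right _ _)


/-- Let `c 0 < c 1 < … < c (n-1)` be natural numbers such that for every prime `p`
there is an integer `x` with `p² ∤ x + c i` for all `i`. Then there is `a : ℕ` such
that `a + c 0, …, a + c (n-1)` are consecutive squarefree integers: each `a + c i` is
squarefree, and every squarefree integer in `[a + c 0, a + c (n-1)]` is of this form. -/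
theorem exists_consecutive_squarefree_pattern
    (n : ℕ) (hn : 0 < n) (c : Fin n → ℕ) (hmono : StrictMono c)
    (hloc : ∀ p : ℕ, p.Prime → ∃ x : ℤ, ∀ i : Fin n, ¬ ((p : ℤ) ^ 2 ∣ x + (c i : ℤ))) :
    ∃ a : ℕ, (∀ i : Fin n, Squarefree ((a : ℤ) + (c i : ℤ))) ∧
      ∀ b : ℤ, Squarefree b →
        (a : ℤ) + (c ⟨0, hn⟩ : ℤ) ≤ b →
        b ≤ (a : ℤ) + (c ⟨n - 1, Nat.sub_lt hn Nat.one_pos⟩ : ℤ) →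
        ∃ i : Fin n, b = (a : ℤ) + (c i : ℤ) := by
  set C := c ⟨n - 1, Nat.sub_lt hn Nat.one_pos⟩ with hC
  have hcC : ∀ i, c i ≤ C := fun i => hmono.monotone (Fin.le_def.2 (by
    have := i.isLt
    simp only
    omega))
  set P := 2 * n + C with hP
  have hex : ∀ p : ℕ, ∃ x : ℕ, p.Prime → (∀ i, ¬ p ^ 2 ∣ x + c i) ∧
      ∀ d, d ∉ Set.range c → p = Nat.nth Nat.Prime (P + d) → p ^ 2 ∣ x + d := by
    intro p
    by_cases hp : p.Prime
    · obtain ⟨x, hx⟩ := exists_residue_of_prime (P := P) c hp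
        (fun i => (hcC i).trans (by omega)) (hloc p hp)
      exact ⟨x, fun _ => hx⟩
    · exact ⟨0, fun h => absurd h hp⟩
  choose x hx using hex
  set B := Nat.nth Nat.Prime (P + C) with hB
  have hBP : P + C + 2 ≤ B := Nat.add_two_le_nth_prime _
  set s := (Finset.range (B + 1)).filter Nat.Prime with hs
  have hmem : ∀ p : ℕ, p.Prime → p ≤ B → p ∈ s := fun p hp hpB =>
    Finset.mem_filter.2 ⟨Finset.mem_range.2 (Nat.lt_succ_of_le hpB), hp⟩
  obtain ⟨b, hb⟩ := Nat.chineseRemainderOfFinset x (fun p => p ^ 2) s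
    (fun p hp => pow_ne_zero _ (Finset.mem_filter.1 hp).2.ne_zero)
    (fun p hp q hq hpq => Nat.Coprime.pow 2 2
      ((Nat.coprime_primes (Finset.mem_filter.1 hp).2 (Finset.mem_filter.1 hq).2).2 hpq))
  set Q := ∏ p ∈ s, p ^ 2 with hQ
  have hmod : ∀ p : ℕ, p.Prime → p ≤ B → ∀ t, b + Q * t ≡ x p [MOD p ^ 2] := by
    intro p hp hpB t
    have h1 : Q * t ≡ 0 [MOD p ^ 2] := (Nat.modEq_zero_iff_dvd).2
      ((Finset.dvd_prod_of_mem (fun p => p ^ 2) (hmem p hp hpB)).mul_right t)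
    exact (hb p (hmem p hp hpB)).add h1
  obtain ⟨t, ht⟩ := exists_forall_squarefree_add_mul (n := n) (P := B) (Q := Q) (b := b) c
    (by omega) (by omega)
    (fun p hp hBp => Nat.Coprime.prod_right fun q hq => by
      rw [hs, Finset.mem_filter, Finset.mem_range] at hq
      exact Nat.Coprime.pow_right 2 ((Nat.coprime_primes hp hq.2).2 (by omega)))
    (fun p hp hpB i t hdvd => (hx p hp).1 i (by
      rw [add_right_comm] at hdvd
      exact (((hmod p hp hpB t).add_right (c i)).dvd_iff dvd_rfl).1 hdvd))
  refine ⟨b + Q * t, fun i => ?_, fun m hm hlo hhi => ?_⟩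
  · rw [← Nat.cast_add, Int.squarefree_natCast, add_right_comm]
    exact ht i
  · obtain ⟨d, rfl⟩ : ∃ d : ℕ, m = ((b + Q * t : ℕ) : ℤ) + d :=
      ⟨(m - ((b + Q * t : ℕ) : ℤ)).toNat, by omega⟩
    by_cases hd : d ∈ Set.range c
    · obtain ⟨i, rfl⟩ := hd
      exact ⟨i, rfl⟩
    · exfalso
      rw [← Nat.cast_add, Int.squarefree_natCast] at hm
      have hdC : d ≤ C := by omega
      set q := Nat.nth Nat.Prime (P + d) with hq
      have hqp : q.Prime := Nat.prime_nth_prime _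
      have hqB : q ≤ B := Nat.nth_monotone Nat.infinite_setOfPred_prime (by omega)
      have hdvd : q ^ 2 ∣ b + Q * t + d :=
        (((hmod q hqp hqB t).add_right d).dvd_iff dvd_rfl).2 ((hx q hqp).2 d hd hq)
      rw [sq] at hdvd
      exact (Nat.squarefree_iff_prime_squarefree.1 hm) q hqp hdvd
end

section
/- For every natural number n ≥ 1 there exists a natural number a such that a + i² is squarefree for every i ∈ {1, …, n}, and every squarefree integer b with a + 1 ≤ b ≤ a + n² is equal to a + i² for some i ∈ {1, …, n} (that is, a + 1², a + 2², …, a + n² are consecutive squarefree integers). -/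
/-- If `d` is coprime to `M`, at most `T / d² + 1` of the terms `c + M * t` with `t < T` are
divisible by `d²`. -/
theorem card_filter_sq_dvd_le (c M d T : ℕ) (hd : d.Coprime M) :
    ((Finset.range T).filter fun t => d ^ 2 ∣ c + M * t).card ≤ T / d ^ 2 + 1 := by
  rw [← Finset.card_range (T / d ^ 2 + 1)]
  refine Finset.card_le_card_of_injOn (fun t => t / d ^ 2) ?_ ?_
  · intro t ht
    simp only [Finset.coe_filter, Finset.mem_range, Set.mem_ofPred_eq] at ht
    simp only [Finset.coe_range, Set.mem_Iio]
    exact Nat.lt_succ_of_le (Nat.div_le_div_right ht.1.le)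
  · intro t ht u hu htu
    simp only [Finset.coe_filter, Finset.mem_range, Set.mem_ofPred_eq] at ht hu
    have h : c + M * t ≡ c + M * u [MOD d ^ 2] :=
      ((Nat.modEq_zero_iff_dvd).2 ht.2).trans ((Nat.modEq_zero_iff_dvd).2 hu.2).symm
    have h' : t ≡ u [MOD d ^ 2] :=
      Nat.ModEq.cancel_left_of_coprime (Nat.Coprime.pow_left 2 hd) (Nat.ModEq.add_left_cancel' c h)
    have htu' : t / d ^ 2 = u / d ^ 2 := htu
    rw [← Nat.div_add_mod t (d ^ 2), ← Nat.div_add_mod u (d ^ 2), htu', h']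

/-- In every arithmetic progression of difference `M` there is a term `a` such that no
`a + i²` with `1 ≤ i ≤ n` is divisible by the square of an integer `d > P` coprime to `M`. -/
theorem exists_forall_not_sq_dvd (n c M P : ℕ) (hn : 1 ≤ n) (hP : 2 * n ≤ P) :
    ∃ t : ℕ, ∀ i, 1 ≤ i → i ≤ n → ∀ d, P < d → d.Coprime M → ¬ d ^ 2 ∣ c + M * t + i ^ 2 := by
  set T := 4 * n ^ 2 * (c + M + n ^ 2) + 1 with hT
  set D := Nat.sqrt (c + M * T + n ^ 2) with hD
  by_contra! hcon
  have hcover : Finset.range T ⊆ (Finset.Icc 1 n).biUnion fun i =>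
      ((Finset.Ioc P D).filter fun d => d.Coprime M).biUnion fun d =>
        (Finset.range T).filter fun t => d ^ 2 ∣ (c + i ^ 2) + M * t := by
    intro t ht
    obtain ⟨i, hi1, hin, d, hPd, hdM, hdvd⟩ := hcon t
    have ht' := Finset.mem_range.1 ht
    simp only [Finset.mem_biUnion, Finset.mem_Icc, Finset.mem_filter, Finset.mem_Ioc]
    refine ⟨i, ⟨hi1, hin⟩, d, ⟨⟨hPd, ?_⟩, hdM⟩, ht, ?_⟩
    · rw [hD, Nat.le_sqrt']
      have h1 : d ^ 2 ≤ c + M * t + i ^ 2 := Nat.le_of_dvd (by positivity) hdvd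
      have h2 : i ^ 2 ≤ n ^ 2 := Nat.pow_le_pow_left hin 2
      have h3 : M * t ≤ M * T := Nat.mul_le_mul_left M ht'.le
      omega
    · convert hdvd using 1
      ring
  have hcard : T ≤ n * ∑ d ∈ Finset.Ioc P D, (T / d ^ 2 + 1) := by
    calc T = (Finset.range T).card := (Finset.card_range T).symm
      _ ≤ _ := Finset.card_le_card hcover
      _ ≤ (Finset.Icc 1 n).card * ∑ d ∈ Finset.Ioc P D, (T / d ^ 2 + 1) := by
        refine Finset.card_biUnion_le_card_mul _ _ _ fun i _ => Finset.card_biUnion_le.trans ?_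
        refine (Finset.sum_le_sum fun d hd => card_filter_sq_dvd_le (c + i ^ 2) M d T
          (Finset.mem_filter.1 hd).2).trans ?_
        exact Finset.sum_le_sum_of_subset (Finset.filter_subset _ _)
      _ = _ := by simp
  have hP0 : 0 < P := by omega
  have hTpos : (0 : ℝ) < T := by rw [hT]; positivity
  have hPR : (0 : ℝ) < P := by exact_mod_cast hP0
  have hnR : (0 : ℝ) < n := by exact_mod_cast hn
  have hinv : ∑ d ∈ Finset.Ioc P D, ((d : ℝ) ^ 2)⁻¹ ≤ (P : ℝ)⁻¹ := by
    rcases le_total P D with h | h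
    · refine (sum_Ioc_inv_sq_le_sub hP0.ne' h).trans ?_
      have : (0 : ℝ) ≤ (D : ℝ)⁻¹ := by positivity
      linarith
    · rw [Finset.Ioc_eq_empty_of_le h]
      simp
  have hsum : (∑ d ∈ Finset.Ioc P D, ((T / d ^ 2 + 1 : ℕ) : ℝ)) ≤ T * (P : ℝ)⁻¹ + D := by
    calc (∑ d ∈ Finset.Ioc P D, ((T / d ^ 2 + 1 : ℕ) : ℝ))
        ≤ ∑ d ∈ Finset.Ioc P D, ((T : ℝ) * ((d : ℝ) ^ 2)⁻¹ + 1) := by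
          refine Finset.sum_le_sum fun d _ => ?_
          have := Nat.cast_div_le (α := ℝ) (m := T) (n := d ^ 2)
          push_cast at this ⊢
          rw [div_eq_mul_inv] at this
          linarith
      _ = T * ∑ d ∈ Finset.Ioc P D, ((d : ℝ) ^ 2)⁻¹ + ((D - P : ℕ) : ℝ) := by
          rw [Finset.sum_add_distrib, ← Finset.mul_sum]
          simp
      _ ≤ T * (P : ℝ)⁻¹ + D := by
          have : ((D - P : ℕ) : ℝ) ≤ D := by exact_mod_cast Nat.sub_le D P
          gcongr
  have hmain : (T : ℝ) ≤ n * (T * (P : ℝ)⁻¹ + D) := by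
    have h : (T : ℝ) ≤ n * ∑ d ∈ Finset.Ioc P D, ((T / d ^ 2 + 1 : ℕ) : ℝ) := by
      exact_mod_cast hcard
    exact h.trans (by gcongr)
  have hhalf : (n : ℝ) * (T * (P : ℝ)⁻¹) ≤ T / 2 := by
    have h2 : (2 * n : ℝ) ≤ P := by exact_mod_cast hP
    have h3 : (n : ℝ) * (P : ℝ)⁻¹ ≤ 1 / 2 := by
      rw [← div_eq_mul_inv, div_le_iff₀ hPR]
      linarith
    nlinarith
  have hTD : T ≤ 2 * n * D := by
    have : (T : ℝ) ≤ 2 * n * D := by linarith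
    exact_mod_cast this
  have hsq : D ^ 2 ≤ c + M * T + n ^ 2 := Nat.sqrt_le' _
  have hT1 : 1 ≤ T := by omega
  have hle : c + M * T + n ^ 2 ≤ (c + M + n ^ 2) * T := by nlinarith
  have hfin : T * T ≤ 4 * n ^ 2 * (c + M + n ^ 2) * T := by
    calc T * T ≤ (2 * n * D) * (2 * n * D) := Nat.mul_le_mul hTD hTD
      _ = 4 * n ^ 2 * D ^ 2 := by ring
      _ ≤ 4 * n ^ 2 * ((c + M + n ^ 2) * T) := Nat.mul_le_mul_left _ (hsq.trans hle)
      _ = _ := by ring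
  have := Nat.le_of_mul_le_mul_right hfin hT1
  omega

/-- A prime is not congruent to a square modulo its own square. -/
theorem Nat.Prime.not_sq_dvd_sq_sub {p : ℕ} (hp : p.Prime) (i : ℤ) :
    ¬ (p : ℤ) ^ 2 ∣ i ^ 2 - p := by
  intro h
  have hpZ : _root_.Prime (p : ℤ) := Nat.prime_iff_prime_int.1 hp
  have h1 : (p : ℤ) ∣ i ^ 2 :=
    (dvd_sub_left (dvd_refl _)).1 ((dvd_pow_self _ two_ne_zero).trans h)
  have h2 : (p : ℤ) ^ 2 ∣ i ^ 2 := pow_dvd_pow_of_dvd (hpZ.dvd_of_dvd_pow h1) 2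
  have h3 : (p : ℤ) ^ 2 ∣ p := (dvd_sub_right h2).1 h
  have h4 : p ^ 2 ∣ p := by exact_mod_cast h3
  have := Nat.le_of_dvd hp.pos h4
  nlinarith [hp.two_le]

/-- For every `n ≥ 1` there is a natural number `a` such that
`a + 1², a + 2², …, a + n²` are consecutive squarefree integers. -/
theorem exists_consecutive_squarefree_squares_gaps
    (n : ℕ) (hn : 1 ≤ n) :
    ∃ a : ℕ, (∀ i : ℕ, 1 ≤ i → i ≤ n → Squarefree ((a : ℤ) + (i : ℤ) ^ 2)) ∧
      ∀ b : ℤ, Squarefree b → (a : ℤ) + 1 ≤ b → b ≤ (a : ℤ) + (n : ℤ) ^ 2 →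
        ∃ i : ℕ, 1 ≤ i ∧ i ≤ n ∧ b = (a : ℤ) + (i : ℤ) ^ 2 := by
  classical
  set P := 2 * n ^ 2 with hP
  set N := P + n ^ 2 + 1 with hN
  set p : ℕ → ℕ := Nat.nth Nat.Prime with hp
  have hprime : ∀ k, (p k).Prime := Nat.prime_nth_prime
  have hlt : ∀ k, k < p k := fun k =>
    (Nat.lt_add_of_pos_right two_pos).trans_le (Nat.add_two_le_nth_prime k)
  have hinj : Function.Injective p := Nat.nth_injective Nat.infinite_setOfPred_prime
  -- `v k` is the shift for which `a + v k` is made divisible by `(p k) ^ 2`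
  set v : ℕ → ℕ := fun k => if P ≤ k ∧ ¬ IsSquare (k - P) then k - P else p k with hv
  obtain ⟨c, hc⟩ := Nat.chineseRemainderOfFinset (fun k => p k ^ 2 * v k - v k)
    (fun k => p k ^ 2) (Finset.range N) (fun k _ => pow_ne_zero 2 (hprime k).ne_zero)
    (fun k _ l _ hkl => Nat.Coprime.pow 2 2
      ((Nat.coprime_primes (hprime k) (hprime l)).2 (hinj.ne hkl)))
  set M := ∏ k ∈ Finset.range N, p k ^ 2 with hM
  have hnn : n ≤ n ^ 2 := Nat.le_self_pow two_ne_zero n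
  obtain ⟨t, ht⟩ := exists_forall_not_sq_dvd n c M P hn (by omega)
  have hdvd : ∀ k < N, p k ^ 2 ∣ c + M * t + v k := by
    intro k hk
    have h1 := (hc k (Finset.mem_range.2 hk)).add_right (v k)
    have h2 : v k ≤ p k ^ 2 * v k := Nat.le_mul_of_pos_left _ (pow_pos (hprime k).pos 2)
    rw [Nat.sub_add_cancel h2] at h1
    have h3 : p k ^ 2 ∣ c + v k := (h1.dvd_iff dvd_rfl).2 (dvd_mul_right _ _)
    have h4 : p k ^ 2 ∣ M * t :=
      (Finset.dvd_prod_of_mem (fun k => p k ^ 2) (Finset.mem_range.2 hk)).mul_right t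
    rw [add_right_comm]
    exact dvd_add h3 h4
  have hsmall : ∀ k < N, ∀ i ≤ n, ¬ p k ^ 2 ∣ c + M * t + i ^ 2 := by
    intro k hk i hi h
    have hd : (p k : ℤ) ^ 2 ∣ (i : ℤ) ^ 2 - v k := by
      have h1 : ((p k ^ 2 : ℕ) : ℤ) ∣ ((c + M * t + i ^ 2 : ℕ) : ℤ) := Int.natCast_dvd_natCast.2 h
      have h2 : ((p k ^ 2 : ℕ) : ℤ) ∣ ((c + M * t + v k : ℕ) : ℤ) :=
        Int.natCast_dvd_natCast.2 (hdvd k hk)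
      have h3 := dvd_sub h1 h2
      push_cast at h3
      rwa [add_sub_add_left_eq_sub] at h3
    by_cases hk' : P ≤ k ∧ ¬ IsSquare (k - P)
    · have hvk : v k = k - P := if_pos hk'
      have hi2 : i ^ 2 ≤ n ^ 2 := Nat.pow_le_pow_left hi 2
      have hpk : n ^ 2 < p k ^ 2 := by nlinarith [hlt k]
      have hz : (i : ℤ) ^ 2 - v k = 0 := by
        refine Int.eq_zero_of_abs_lt_dvd hd ?_
        rw [abs_lt]
        zify at hi2 hpk
        have hv0 : (0 : ℤ) ≤ v k := Int.natCast_nonneg _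
        have hv1 : (v k : ℤ) ≤ (n : ℤ) ^ 2 := by
          have : v k ≤ n ^ 2 := by omega
          exact_mod_cast this
        constructor <;> nlinarith [sq_nonneg (i : ℤ)]
      have hz' : i ^ 2 = k - P := by
        rw [← hvk]
        zify
        linarith
      exact hk'.2 ⟨i, by rw [← hz', sq]⟩
    · have hvk : v k = p k := if_neg hk'
      rw [hvk] at hd
      exact (hprime k).not_sq_dvd_sq_sub i hd
  refine ⟨c + M * t, ?_, ?_⟩
  · intro i hi1 hin
    have hnat : Squarefree (c + M * t + i ^ 2) := by
      rw [Nat.squarefree_iff_prime_squarefree]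
      intro q hq hqd
      rw [← sq] at hqd
      have hqk : p (Nat.count Nat.Prime q) = q := Nat.nth_count hq
      by_cases hk : Nat.count Nat.Prime q < N
      · exact hsmall _ hk i hin (by rwa [hqk])
      · refine ht i hi1 hin q ?_ ?_ hqd
        · have := hlt (Nat.count Nat.Prime q)
          rw [hqk] at this
          omega
        · refine Nat.Coprime.prod_right fun k hk' => Nat.Coprime.pow_right 2 ?_
          refine (Nat.coprime_primes hq (hprime k)).2 fun h => hk ?_
          rw [h, hp, Nat.count_nth_of_infinite Nat.infinite_setOfPred_prime]
          exact Finset.mem_range.1 hk'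
    have := Int.squarefree_natCast.2 hnat
    exact_mod_cast this
  · intro b hb hb1 hb2
    obtain ⟨j, hj⟩ := Int.eq_ofNat_of_zero_le (show 0 ≤ b - (c + M * t : ℕ) by linarith)
    have hbj : b = ((c + M * t + j : ℕ) : ℤ) := by push_cast at hj ⊢; linarith
    have hj1 : 1 ≤ j := by
      rw [hbj] at hb1
      push_cast at hb1
      zify
      linarith
    have hj2 : j ≤ n ^ 2 := by
      rw [hbj] at hb2
      push_cast at hb2
      zify
      linarith
    have hsq : IsSquare j := by
      by_contra hns
      have hvk : v (P + j) = j := by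
        simp [hv, hns]
      have h := hdvd (P + j) (by omega)
      rw [hvk] at h
      rw [hbj, Int.squarefree_natCast] at hb
      rw [sq] at h
      exact (hprime (P + j)).not_isUnit (hb _ h)
    obtain ⟨i, rfl⟩ := hsq
    refine ⟨i, Nat.pos_of_ne_zero ?_, ?_, ?_⟩
    · rintro rfl
      omega
    · nlinarith
    · rw [hbj]
      push_cast
      ring
end

section
/- Let k be a nonzero integer and let c_1, …, c_n, c'_1, …, c'_{n'} be rational numbers such that all n + n' of them are pairwise distinct. Then for all rational numbers b < b' there exists a rational number a with b < a < b' such that k·a + c_i is a squarefree rational number for every i ∈ {1, …, n}, and for every j ∈ {1, …, n'} the number k·a + c'_j is nonzero and not squarefree (i.e., v_p(k·a + c'_j) ≥ 2 for some prime p). -/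
section

open Finset

/-- Among `H` consecutive terms of an arithmetic progression whose step is coprime to `d`,
at most `H / d + 1` are divisible by `d`. -/
lemma card_filter_dvd_add_mul_le_s13 (H d : ℕ) (hd : 0 < d) (g Q : ℤ) (hQ : IsCoprime (d : ℤ) Q) :
    #{s ∈ range H | (d : ℤ) ∣ g + Q * (s : ℕ)} ≤ H / d + 1 := by
  rcases Finset.eq_empty_or_nonempty {s ∈ range H | (d : ℤ) ∣ g + Q * (s : ℕ)} with h | ⟨s₀, h₀⟩
  · simp [h]
  · simp only [mem_filter] at h₀
    have hsub : {s ∈ range H | (d : ℤ) ∣ g + Q * (s : ℕ)} ⊆ {s ∈ range H | s ≡ s₀ [MOD d]} := by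
      intro s hs
      simp only [mem_filter] at hs ⊢
      refine ⟨hs.1, ?_⟩
      rw [← Int.natCast_modEq_iff, Int.modEq_comm, Int.modEq_iff_dvd]
      refine hQ.dvd_of_dvd_mul_left ?_
      have h := dvd_sub hs.2 h₀.2
      rwa [add_sub_add_left_eq_sub, ← mul_sub] at h
    refine (card_le_card hsub).trans ?_
    rw [← Nat.count_eq_card_filter_range, Nat.count_modEq_card _ hd]
    split_ifs <;> omega

open Classical in
/-- Few terms of an arithmetic progression are zero or divisible by the square of a large prime. -/
lemma card_filter_sq_dvd_le_s13 (M H Y : ℕ) (hM : 0 < M) (g Q : ℤ) (hQ : Q ≠ 0)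
    (hY : ∀ s < H, |g + Q * (s : ℕ)| < ((Y : ℤ) + 1) ^ 2) :
    (#{s ∈ range H | g + Q * (s : ℕ) = 0 ∨ ∃ p : ℕ, p.Prime ∧ M < p ∧ ¬ (p : ℤ) ∣ Q ∧
      (p : ℤ) ^ 2 ∣ g + Q * (s : ℕ)} : ℚ) ≤ H / M + Y + 1 := by
  set Z : Finset ℕ := {s ∈ range H | g + Q * (s : ℕ) = 0}
  set P : Finset ℕ := {p ∈ Ioc M Y | p.Prime ∧ ¬ (p : ℤ) ∣ Q}
  set F : ℕ → Finset ℕ := fun p => {s ∈ range H | ((p ^ 2 : ℕ) : ℤ) ∣ g + Q * (s : ℕ)}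
  have hsub : {s ∈ range H | g + Q * (s : ℕ) = 0 ∨ ∃ p : ℕ, p.Prime ∧ M < p ∧ ¬ (p : ℤ) ∣ Q ∧
      (p : ℤ) ^ 2 ∣ g + Q * (s : ℕ)} ⊆ Z ∪ P.biUnion F := by
    intro s hs
    simp only [mem_filter, Z, P, F, mem_union, mem_biUnion, mem_Ioc] at hs ⊢
    obtain ⟨hs, h⟩ := hs
    by_cases h0 : g + Q * (s : ℕ) = 0
    · exact Or.inl ⟨hs, h0⟩
    · obtain ⟨p, hp, hMp, hpQ, hd⟩ := h.resolve_left h0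
      refine Or.inr ⟨p, ⟨⟨hMp, ?_⟩, hp, hpQ⟩, hs, by exact_mod_cast hd⟩
      have h1 := Int.le_of_dvd (abs_pos.2 h0) ((dvd_abs _ _).2 hd)
      have h2 := lt_of_le_of_lt h1 (hY s (mem_range.1 hs))
      have h3 := lt_of_pow_lt_pow_left₀ 2 (by positivity) h2
      omega
  have hZ : #Z ≤ 1 := by
    refine card_le_one.2 fun a ha b hb => ?_
    simp only [Z, mem_filter] at ha hb
    have : Q * (a : ℤ) = Q * b := by linarith [ha.2, hb.2]
    exact_mod_cast mul_left_cancel₀ hQ this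
  have hF : ∀ p ∈ P, (#(F p) : ℚ) ≤ H * ((p : ℚ) ^ 2)⁻¹ + 1 := by
    intro p hp
    simp only [P, mem_filter] at hp
    have hcop : IsCoprime ((p ^ 2 : ℕ) : ℤ) Q := by
      push_cast
      exact ((Nat.prime_iff_prime_int.1 hp.2.1).irreducible.coprime_iff_not_dvd.2 hp.2.2).pow_left
    have h1 := card_filter_dvd_add_mul_le_s13 H (p ^ 2) (pow_pos hp.2.1.pos 2) g Q hcop
    have h2 : ((H / p ^ 2 : ℕ) : ℚ) ≤ H * ((p : ℚ) ^ 2)⁻¹ := by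
      have h := Nat.cast_div_le (α := ℚ) (m := H) (n := p ^ 2)
      rwa [div_eq_mul_inv, Nat.cast_pow] at h
    calc (#(F p) : ℚ) ≤ ((H / p ^ 2 + 1 : ℕ) : ℚ) := by exact_mod_cast h1
      _ ≤ _ := by push_cast at h2 ⊢; linarith
  have hsum : ∑ p ∈ P, ((H : ℚ) * ((p : ℚ) ^ 2)⁻¹ + 1) ≤ H / M + Y := by
    refine (sum_le_sum_of_subset_of_nonneg (filter_subset _ _)
      fun _ _ _ => by positivity).trans ?_
    rw [sum_add_distrib, ← mul_sum, sum_const, Nat.card_Ioc, nsmul_one, div_eq_mul_inv]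
    have hY : ((Y - M : ℕ) : ℚ) ≤ Y := by exact_mod_cast Nat.sub_le _ _
    refine add_le_add (mul_le_mul_of_nonneg_left ?_ (by positivity)) hY
    rcases le_total M Y with h | h
    · refine (sum_Ioc_inv_sq_le_sub hM.ne' h).trans ?_
      have : (0 : ℚ) ≤ (Y : ℚ)⁻¹ := by positivity
      linarith
    · rw [Ioc_eq_empty_of_le h, sum_empty]; positivity
  have h1 : (#(P.biUnion F) : ℚ) ≤ H / M + Y := by
    refine le_trans ?_ ((sum_le_sum hF).trans hsum)
    exact_mod_cast card_biUnion_le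
  have h2 := (card_le_card hsub).trans (card_union_le _ _)
  have h3 : (#Z : ℚ) ≤ 1 := by exact_mod_cast hZ
  refine le_trans (Nat.cast_le.2 h2) ?_
  push_cast
  linarith

/-- Finitely many arithmetic progressions with common step simultaneously avoid zero, and some of
them also the multiples of squares of large primes, provided that sufficiently many terms are
considered. -/
lemma exists_forall_not_sq_dvd_s13 {n n' M H Y : ℕ} (hM : 0 < M) (hn : 2 * n ≤ M) (Q : ℤ) (hQ : Q ≠ 0)
    (g : Fin n → ℤ) (g' : Fin n' → ℤ)
    (hY : ∀ i, ∀ s < H, |g i + Q * (s : ℕ)| < ((Y : ℤ) + 1) ^ 2)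
    (hH : 2 * (n * Y + n + n') < H) :
    ∃ s < H, (∀ i, g i + Q * (s : ℕ) ≠ 0 ∧ ∀ p : ℕ, p.Prime → M < p → ¬ (p : ℤ) ∣ Q →
      ¬ (p : ℤ) ^ 2 ∣ g i + Q * (s : ℕ)) ∧ ∀ j, g' j + Q * (s : ℕ) ≠ 0 := by
  classical
  set A : Fin n → Finset ℕ := fun i => {s ∈ range H | g i + Q * (s : ℕ) = 0 ∨
    ∃ p : ℕ, p.Prime ∧ M < p ∧ ¬ (p : ℤ) ∣ Q ∧ (p : ℤ) ^ 2 ∣ g i + Q * (s : ℕ)}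
  set Z : Fin n' → Finset ℕ := fun j => {s ∈ range H | g' j + Q * (s : ℕ) = 0}
  have hA : ∀ i, (#(A i) : ℚ) ≤ H / M + Y + 1 := fun i =>
    card_filter_sq_dvd_le_s13 M H Y hM (g i) Q hQ (hY i)
  have hZ : ∀ j, #(Z j) ≤ 1 := by
    refine fun j => card_le_one.2 fun a ha b hb => ?_
    simp only [Z, mem_filter] at ha hb
    have : Q * (a : ℤ) = Q * b := by linarith [ha.2, hb.2]
    exact_mod_cast mul_left_cancel₀ hQ this
  have hA' : (#(univ.biUnion A) : ℚ) ≤ n * (H / M + Y + 1) := by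
    refine le_trans (b := ∑ i, (#(A i) : ℚ)) (by exact_mod_cast card_biUnion_le) ?_
    refine (sum_le_sum fun i _ => hA i).trans (le_of_eq ?_)
    rw [sum_const, card_univ, Fintype.card_fin, nsmul_eq_mul]
  have hZ' : (#(univ.biUnion Z) : ℚ) ≤ n' := by
    have : #(univ.biUnion Z) ≤ n' := by
      refine card_biUnion_le.trans ((sum_le_sum fun j _ => hZ j).trans ?_)
      simp
    exact_mod_cast this
  have hhalf : (n : ℚ) * (H / M) ≤ H / 2 := by
    have hM' : (0 : ℚ) < M := by exact_mod_cast hM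
    have hn' : (2 * n : ℚ) ≤ M := by exact_mod_cast hn
    rw [mul_div_assoc', div_le_div_iff₀ hM' two_pos]
    nlinarith [(Nat.cast_nonneg H : (0 : ℚ) ≤ H)]
  have hH' : (2 * (n * Y + n + n') : ℚ) < H := by exact_mod_cast hH
  have hlt : #(univ.biUnion A ∪ univ.biUnion Z) < #(range H) := by
    have h := card_union_le (univ.biUnion A) (univ.biUnion Z)
    rw [card_range]
    have h' : (#(univ.biUnion A ∪ univ.biUnion Z) : ℚ) ≤
        #(univ.biUnion A) + #(univ.biUnion Z) := by exact_mod_cast h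
    have : (#(univ.biUnion A ∪ univ.biUnion Z) : ℚ) < H := by
      nlinarith
    exact_mod_cast this
  obtain ⟨s, hs, hs'⟩ := exists_mem_notMem_of_card_lt_card hlt
  have hsH := mem_range.1 hs
  simp only [mem_union, mem_biUnion, mem_univ, true_and, A, Z, mem_filter, hs, not_or,
    not_exists] at hs'
  refine ⟨s, hsH, fun i => ⟨(hs'.1 i).1, fun p hp hMp hpQ hd => (hs'.1 i).2 p ⟨hp, hMp, hpQ, hd⟩⟩,
    hs'.2⟩

/-- A linear function eventually dominates the square root of another one. -/
lemma exists_forall_sqrt_lt_div (C K a b : ℕ) (hK : 0 < K) :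
    ∃ N₀ : ℕ, ∀ N ≥ N₀, a * Nat.sqrt (C * N) + b < N / K := by
  refine ⟨2 * K * (b + 1) + (C + 1) * (a * K) ^ 2 * 4 + 1, fun N hN => ?_⟩
  rw [Nat.lt_iff_add_one_le, Nat.le_div_iff_mul_le hK]
  have hy := Nat.sqrt_le (C * N)
  set y := Nat.sqrt (C * N)
  have h1 : 2 * (a * K) * y ≤ N := by
    by_contra! h
    have : N * N < (2 * (a * K) * y) * (2 * (a * K) * y) := Nat.mul_self_lt_mul_self h
    have h2 : (2 * (a * K) * y) * (2 * (a * K) * y) ≤ 4 * (a * K) ^ 2 * (C * N) := by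
      calc _ = 4 * (a * K) ^ 2 * (y * y) := by ring
        _ ≤ _ := by gcongr
    have h3 : 4 * (a * K) ^ 2 * C ≤ N := by nlinarith
    nlinarith
  nlinarith

/-- Integer core of the theorem: for suitable `N`, some integer `m` between `β * N` and `β' * N`
makes all `m + N * e i` squarefree, while each `m + N * e' j` is divisible by the square of a prime
not dividing `N * D`. -/
lemma exists_squarefree_add_mul {n n' : ℕ} (e : Fin n → ℤ) (e' : Fin n' → ℤ)
    (he : ∀ i j, e i ≠ e' j) {D : ℕ} (hD : 0 < D) {β β' : ℚ} (hβ : β < β') :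
    ∃ (m : ℤ) (N : ℕ), 0 < N ∧ β * N < m ∧ m < β' * N ∧ (∀ i, Squarefree (m + N * e i)) ∧
      ∀ j, m + N * e' j ≠ 0 ∧ ∃ q : ℕ, q.Prime ∧ (q : ℤ) ^ 2 ∣ m + N * e' j ∧ ¬ q ∣ N * D := by
  classical
  set M : ℕ := 2 * n + 2
  set S : ℕ := D * M.factorial
  have hS : 2 ≤ S := by
    have h : 2 ≤ M := by omega
    calc 2 ≤ M := h
      _ ≤ M.factorial := Nat.self_le_factorial M
      _ ≤ S := Nat.le_mul_of_pos_left _ hD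
  set T : ℕ := S + ∑ i, ∑ j, (e i - e' j).natAbs
  set q : Fin n' → ℕ := fun j => Nat.nth Nat.Prime (T + j)
  have hq : ∀ j, (q j).Prime := fun j => Nat.prime_nth_prime _
  have hTq : ∀ j, T < q j := fun j => by
    have := Nat.add_two_le_nth_prime (T + j)
    simp only [q]; omega
  have hqS : ∀ j, ¬ q j ∣ S := fun j h => by
    have := Nat.le_of_dvd (by omega) h
    have := hTq j
    omega
  have hqe : ∀ i j, ¬ (q j : ℤ) ∣ e i - e' j := fun i j h => by
    have h1 := Nat.le_of_dvd (Int.natAbs_pos.2 (sub_ne_zero.2 (he i j))) (Int.natCast_dvd.1 h)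
    have h2 : (e i - e' j).natAbs ≤ ∑ j, (e i - e' j).natAbs :=
      single_le_sum (f := fun j => (e i - e' j).natAbs) (fun _ _ => Nat.zero_le _) (mem_univ j)
    have h3 : ∑ j, (e i - e' j).natAbs ≤ ∑ i, ∑ j, (e i - e' j).natAbs :=
      single_le_sum (f := fun i => ∑ j, (e i - e' j).natAbs) (fun _ _ => Nat.zero_le _) (mem_univ i)
    have := hTq j
    omega
  have hqinj : Function.Injective q := fun a b h => by
    have := Nat.nth_injective Nat.infinite_setOfPred_prime h
    exact Fin.ext (by omega)
  set Q : ℕ := S * ∏ j, q j ^ 2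
  have hQ : 0 < Q := Nat.mul_pos (by omega) (prod_pos fun j _ => pow_pos (hq j).pos 2)
  obtain ⟨K, hK⟩ := exists_nat_gt ((Q : ℚ) / (β' - β))
  have hK0 : (0 : ℚ) < K := lt_of_le_of_lt (div_nonneg (by positivity) (by linarith)) hK
  obtain ⟨C, hC⟩ := exists_nat_ge (|β| + |β'| + ∑ i, |(e i : ℚ)|)
  obtain ⟨N₀, hN₀⟩ := exists_forall_sqrt_lt_div C K (2 * n) (2 * (n + n')) (by exact_mod_cast hK0)
  set N : ℕ := S ^ (N₀ + 1)
  have hN : N₀ ≤ N := (Nat.lt_pow_self (n := N₀ + 1) (show 1 < S by omega)).le.trans' (by omega)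
  have hN0 : 0 < N := pow_pos (by omega) _
  have hSN : S ∣ N := dvd_pow_self _ (by omega)
  have hqN : ∀ j, ¬ q j ∣ N := fun j h => hqS j ((hq j).dvd_of_dvd_pow h)
  have hNQ : (0 : ℚ) < N := by exact_mod_cast hN0
  have hQQ : (0 : ℚ) < Q := by exact_mod_cast hQ
  obtain ⟨m₀, hm₀S, hm₀q⟩ : ∃ m₀ : ℤ, (S : ℤ) ∣ m₀ - 1 ∧
      ∀ j, (q j : ℤ) ^ 2 ∣ m₀ + N * e' j := by
    have hcop : Pairwise (Function.onFun IsCoprime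
        (fun o : Option (Fin n') => Ideal.span {o.elim (S : ℤ) fun j => (q j : ℤ) ^ 2})) := by
      have hSq : ∀ j, IsCoprime (S : ℤ) ((q j : ℤ) ^ 2) := fun j =>
        (Nat.isCoprime_iff_coprime.2 (((hq j).coprime_iff_not_dvd.2 (hqS j)).symm)).pow_right
      rintro (_ | a) (_ | b) hab
      · exact absurd rfl hab
      · exact (Ideal.isCoprime_span_singleton_iff _ _).2 (hSq b)
      · exact (Ideal.isCoprime_span_singleton_iff _ _).2 (hSq a).symm
      · refine (Ideal.isCoprime_span_singleton_iff _ _).2 (IsCoprime.pow ?_)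
        refine Nat.isCoprime_iff_coprime.2 ((Nat.coprime_primes (hq a) (hq b)).2 fun h => hab ?_)
        rw [hqinj h]
    obtain ⟨r, hr⟩ := Ideal.exists_forall_sub_mem_ideal hcop
      (fun o => o.elim 1 fun j => -(N * e' j))
    refine ⟨r, Ideal.mem_span_singleton.1 (hr none), fun j => ?_⟩
    simpa using Ideal.mem_span_singleton.1 (hr (some j))
  set A : ℤ := m₀ + Q * (⌊(β * N - m₀) / Q⌋ + 1)
  have hA : β * N < A := by
    have := Int.lt_floor_add_one ((β * N - m₀) / Q)
    rw [div_lt_iff₀ hQQ] at this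
    simp only [A]; push_cast; linarith
  have hA' : (A : ℚ) ≤ β * N + Q := by
    have := Int.floor_le ((β * N - m₀) / Q)
    rw [le_div_iff₀ hQQ] at this
    simp only [A]; push_cast; linarith
  set H : ℕ := N / K
  have hHN : (Q : ℚ) * H < (β' - β) * N := by
    have h1 : (H : ℚ) ≤ N / K := Nat.cast_div_le
    rw [div_lt_iff₀ (by linarith)] at hK
    calc (Q : ℚ) * H ≤ Q * (N / K) := by gcongr
      _ = Q / K * N := by ring
      _ < _ := by
        gcongr
        rw [div_lt_iff₀ hK0]; linarith
  have hlow : ∀ s : ℕ, β * N < (A + Q * s : ℤ) := fun s => by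
    push_cast
    have : (0 : ℚ) ≤ Q * s := by positivity
    linarith
  have hupp : ∀ s < H, ((A + Q * s : ℤ) : ℚ) < β' * N := fun s hs => by
    have h1 : (s : ℚ) + 1 ≤ H := by exact_mod_cast hs
    push_cast
    nlinarith
  set Y : ℕ := Nat.sqrt (C * N)
  have hbound : ∀ i, ∀ s < H, |A + N * e i + (Q : ℤ) * (s : ℕ)| < ((Y : ℤ) + 1) ^ 2 := by
    intro i s hs
    have h1 := hlow s
    have h2 := hupp s hs
    have h3 : |((A + Q * s : ℤ) : ℚ)| ≤ (|β| + |β'|) * N := by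
      rw [abs_le]
      have h4 := mul_le_mul_of_nonneg_right (neg_abs_le β) hNQ.le
      have h5 := mul_le_mul_of_nonneg_right (le_abs_self β') hNQ.le
      have h6 := mul_nonneg (abs_nonneg β) hNQ.le
      have h7 := mul_nonneg (abs_nonneg β') hNQ.le
      constructor <;> linarith
    have h4 : |(e i : ℚ)| ≤ ∑ i, |(e i : ℚ)| :=
      single_le_sum (f := fun i => |(e i : ℚ)|) (fun _ _ => abs_nonneg _) (mem_univ i)
    have h5 : |((A + N * e i + (Q : ℤ) * (s : ℕ) : ℤ) : ℚ)| ≤ C * N := by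
      calc |((A + N * e i + (Q : ℤ) * (s : ℕ) : ℤ) : ℚ)|
          = |((A + Q * s : ℤ) : ℚ) + N * e i| := by push_cast; ring_nf
        _ ≤ |((A + Q * s : ℤ) : ℚ)| + |(N : ℚ) * e i| := abs_add_le _ _
        _ = |((A + Q * s : ℤ) : ℚ)| + |(e i : ℚ)| * N := by
          rw [abs_mul, Nat.abs_cast, mul_comm (N : ℚ)]
        _ ≤ (|β| + |β'|) * N + (∑ i, |(e i : ℚ)|) * N := by gcongr
        _ = (|β| + |β'| + ∑ i, |(e i : ℚ)|) * N := by ring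
        _ ≤ C * N := by gcongr
    have h6 : |A + N * e i + (Q : ℤ) * (s : ℕ)| ≤ (C * N : ℕ) := by
      have : ((|A + N * e i + (Q : ℤ) * (s : ℕ)| : ℤ) : ℚ) ≤ ((C * N : ℕ) : ℤ) := by
        rw [Int.cast_abs]; push_cast at h5 ⊢; exact h5
      exact_mod_cast this
    refine h6.trans_lt ?_
    exact_mod_cast Nat.lt_succ_sqrt' (C * N)
  obtain ⟨s, hs, hsq, hne⟩ := exists_forall_not_sq_dvd_s13 (M := M) (by omega) (by omega) (Q : ℤ)
    (by exact_mod_cast hQ.ne') (fun i => A + N * e i) (fun j => A + N * e' j) hbound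
    (by have := hN₀ N hN
        calc 2 * (n * Y + n + n') = 2 * n * Y + 2 * (n + n') := by ring
          _ < H := this)
  have hSm : (S : ℤ) ∣ A + Q * s - 1 := by
    have h1 : (S : ℤ) ∣ Q := by exact_mod_cast Dvd.intro _ rfl
    have h2 : A + Q * s - 1 = (m₀ - 1) + Q * (⌊(β * N - m₀) / Q⌋ + 1 + s) := by
      simp only [A]; ring
    rw [h2]
    exact dvd_add hm₀S (h1.mul_right _)
  have hqm : ∀ j, (q j : ℤ) ^ 2 ∣ A + Q * s + N * e' j := fun j => by
    have h1 : (q j : ℤ) ^ 2 ∣ Q := by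
      have : q j ^ 2 ∣ Q := (dvd_prod_of_mem (fun j => q j ^ 2) (mem_univ j)).mul_left _
      exact_mod_cast this
    have h2 : A + Q * s + N * e' j =
        (m₀ + N * e' j) + Q * (⌊(β * N - m₀) / Q⌋ + 1 + s) := by
      simp only [A]; ring
    rw [h2]
    exact dvd_add (hm₀q j) (h1.mul_right _)
  refine ⟨A + Q * s, N, hN0, hlow s, hupp s hs, fun i => ?_, fun j => ⟨?_, q j, hq j, hqm j, ?_⟩⟩
  · rw [← Int.squarefree_natAbs, Nat.squarefree_iff_prime_squarefree]
    intro p hp hpp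
    have hp2 : (p : ℤ) ^ 2 ∣ A + Q * s + N * e i := by
      rw [pow_two]
      exact_mod_cast Int.natCast_dvd.2 hpp
    have hp1 : (p : ℤ) ∣ A + Q * s + N * e i := (dvd_pow_self _ two_ne_zero).trans hp2
    have hpS : ¬ p ∣ S := fun h => by
      have h1 : (p : ℤ) ∣ S := by exact_mod_cast h
      have h2 : (p : ℤ) ∣ N := by exact_mod_cast h.trans hSN
      have h3 : (p : ℤ) ∣ 1 := by
        have := dvd_sub (dvd_sub hp1 (h2.mul_right (e i))) (h1.trans hSm)
        rwa [add_sub_cancel_right, sub_sub_cancel] at this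
      exact hp.one_lt.ne' (by exact_mod_cast Int.eq_one_of_dvd_one (by positivity) h3)
    have hpq : ∀ j, ¬ p ∣ q j ^ 2 := fun j h => by
      obtain rfl := (Nat.prime_dvd_prime_iff_eq hp (hq j)).1 (hp.dvd_of_dvd_pow h)
      have h1 := dvd_sub hp1 ((dvd_pow_self _ two_ne_zero).trans (hqm j))
      rw [add_sub_add_left_eq_sub, ← mul_sub] at h1
      refine (Int.Prime.dvd_mul' (hq j) h1).elim (fun h2 => hqN j ?_) (hqe i j)
      exact_mod_cast h2
    have hpQ : ¬ (p : ℤ) ∣ Q := fun h => by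
      rcases hp.dvd_mul.1 (Int.natCast_dvd_natCast.1 h) with h | h
      · exact hpS h
      · obtain ⟨j, -, hj⟩ := (hp.prime.dvd_finsetProd_iff _).1 h
        exact hpq j hj
    have hMp : M < p := by
      by_contra! h
      exact hpS ((hp.dvd_factorial.2 h).mul_left _)
    refine (hsq i).2 p hp hMp hpQ ?_
    rwa [add_right_comm]
  · have := hne j
    rwa [add_right_comm] at this
  · rw [(hq j).dvd_mul]
    exact fun h => h.elim (hqN j) fun h => hqS j (h.mul_right _)

/-- Finitely many rational numbers have a common denominator. -/
lemma exists_common_denominator {ι : Type*} [Fintype ι] (f : ι → ℚ) :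
    ∃ D : ℕ, 0 < D ∧ ∃ e : ι → ℤ, ∀ i, f i = e i / D := by
  have hD : 0 < ∏ i, (f i).den := prod_pos fun i _ => (f i).den_pos
  refine ⟨∏ i, (f i).den, hD, ?_⟩
  have h : ∀ i, ∃ z : ℤ, f i = z / (∏ i, (f i).den : ℕ) := fun i => by
    obtain ⟨w, hw⟩ := dvd_prod_of_mem (fun i => (f i).den) (mem_univ i)
    refine ⟨(f i).num * w, ?_⟩
    have hD' : ((∏ i, (f i).den : ℕ) : ℚ) ≠ 0 := by exact_mod_cast hD.ne'
    rw [eq_div_iff hD', hw]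
    push_cast
    rw [← mul_assoc, Rat.mul_den_eq_num]
  choose e he using h
  exact ⟨e, he⟩

end

/-- A fraction with squarefree numerator is squarefree. -/
lemma SquarefreeRat.of_squarefree_div {z : ℤ} (hz : Squarefree z) {d : ℕ} (hd : 0 < d) :
    SquarefreeRat (z / d) := by
  have hz0 : (z : ℚ) ≠ 0 := by exact_mod_cast hz.ne_zero
  have hd0 : (d : ℚ) ≠ 0 := by exact_mod_cast hd.ne'
  refine ⟨div_ne_zero hz0 hd0, fun p hp => ?_⟩
  have := Fact.mk hp
  rw [padicValRat.div hz0 hd0, padicValRat.of_int, padicValRat.of_nat]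
  have h : ¬ 2 ≤ padicValInt p z := fun h => by
    have h1 := (padicValInt_dvd_iff 2 z).2 (Or.inr h)
    rw [pow_two] at h1
    exact (Nat.prime_iff_prime_int.1 hp).not_isUnit (hz _ h1)
  omega

/-- A fraction is not squarefree if its numerator is divisible by the square of a prime which does
not divide the denominator. -/
lemma not_squarefreeRat_div {z : ℤ} (hz : z ≠ 0) {d q : ℕ} (hd : 0 < d) (hq : q.Prime)
    (hqz : (q : ℤ) ^ 2 ∣ z) (hqd : ¬ q ∣ d) : ¬ SquarefreeRat (z / d) := by
  intro h
  have hz0 : (z : ℚ) ≠ 0 := by exact_mod_cast hz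
  have hd0 : (d : ℚ) ≠ 0 := by exact_mod_cast hd.ne'
  have := Fact.mk hq
  have h1 := h.2 q hq
  rw [padicValRat.div hz0 hd0, padicValRat.of_int, padicValRat.of_nat,
    padicValNat.eq_zero_of_not_dvd hqd] at h1
  have h2 := ((padicValInt_dvd_iff 2 z).1 hqz).resolve_left hz
  omega

/-- The case `k = 1` of the theorem. -/
lemma exists_squarefreeRat_add {n n' : ℕ} (c : Fin n → ℚ) (c' : Fin n' → ℚ)
    (hc : ∀ i j, c i ≠ c' j) {b b' : ℚ} (hb : b < b') :
    ∃ x : ℚ, b < x ∧ x < b' ∧ (∀ i, SquarefreeRat (x + c i)) ∧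
      ∀ j, x + c' j ≠ 0 ∧ ¬ SquarefreeRat (x + c' j) := by
  obtain ⟨D, hD, e, he⟩ := exists_common_denominator (Sum.elim c c')
  have hD0 : (0 : ℚ) < D := by exact_mod_cast hD
  obtain ⟨m, N, hN, hlow, hupp, hsq, hns⟩ := exists_squarefree_add_mul
    (fun i => e (Sum.inl i)) (fun j => e (Sum.inr j))
    (fun i j h => hc i j <| by
      have h1 := he (Sum.inl i)
      have h2 := he (Sum.inr j)
      simp only [Sum.elim_inl, Sum.elim_inr] at h h1 h2
      rw [h1, h2, h]) hD (mul_lt_mul_of_pos_right hb hD0)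
  have hN0 : (0 : ℚ) < N := by exact_mod_cast hN
  have hND : 0 < N * D := Nat.mul_pos hN hD
  have hadd : ∀ t : ℤ, (m : ℚ) / (N * D : ℕ) + t / D = (m + N * t : ℤ) / (N * D : ℕ) :=
    fun t => by
      push_cast
      field_simp
  have hl : ∀ i, c i = e (Sum.inl i) / D := fun i => he (Sum.inl i)
  have hr : ∀ j, c' j = e (Sum.inr j) / D := fun j => he (Sum.inr j)
  refine ⟨m / (N * D : ℕ), ?_, ?_, fun i => ?_, fun j => ?_⟩
  · rw [lt_div_iff₀ (by exact_mod_cast hND)]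
    push_cast
    linarith
  · rw [div_lt_iff₀ (by exact_mod_cast hND)]
    push_cast
    linarith
  · rw [hl, hadd]
    exact .of_squarefree_div (hsq i) hND
  · obtain ⟨h0, q, hq, hqz, hqd⟩ := hns j
    rw [hr, hadd]
    exact ⟨div_ne_zero (by exact_mod_cast h0) (by exact_mod_cast hND.ne'),
      not_squarefreeRat_div h0 hND hq hqz hqd⟩

/-- Genericity of `(ℚ; <, Sqf)`: for a nonzero integer `k` and pairwise distinct
rationals `c 1, …, c n, c' 1, …, c' n'`, every interval `(b, b')` contains a rational
`a` such that each `k·a + c i` is a squarefree rational and each `k·a + c' j` is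
nonzero and not squarefree. -/
theorem rat_system_satisfiable_in_every_interval
    (k : ℤ) (hk : k ≠ 0) (n n' : ℕ) (c : Fin n → ℚ) (c' : Fin n' → ℚ)
    (hdist : Function.Injective (Sum.elim c c')) :
    ∀ b b' : ℚ, b < b' → ∃ a : ℚ, b < a ∧ a < b' ∧
      (∀ i : Fin n, SquarefreeRat ((k : ℚ) * a + c i)) ∧
      (∀ j : Fin n', (k : ℚ) * a + c' j ≠ 0 ∧ ¬ SquarefreeRat ((k : ℚ) * a + c' j)) := by
  intro b b' hb
  have hk0 : (k : ℚ) ≠ 0 := by exact_mod_cast hk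
  have hc : ∀ i j, c i ≠ c' j := fun i j h => Sum.inl_ne_inr (hdist (a₁ := .inl i) (a₂ := .inr j) h)
  rcases lt_or_gt_of_ne hk0 with hneg | hpos
  · obtain ⟨x, h1, h2, h3, h4⟩ :=
      exists_squarefreeRat_add c c' hc (mul_lt_mul_of_neg_left hb hneg)
    refine ⟨x / k, ?_, ?_, ?_⟩
    · rwa [lt_div_iff_of_neg hneg, mul_comm]
    · rwa [div_lt_iff_of_neg hneg, mul_comm]
    · rw [mul_div_cancel₀ _ hk0]
      exact ⟨h3, h4⟩
  · obtain ⟨x, h1, h2, h3, h4⟩ :=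
      exists_squarefreeRat_add c c' hc (mul_lt_mul_of_pos_left hb hpos)
    refine ⟨x / k, ?_, ?_, ?_⟩
    · rwa [lt_div_iff₀ hpos, mul_comm]
    · rwa [div_lt_iff₀ hpos, mul_comm]
    · rw [mul_div_cancel₀ _ hk0]
      exact ⟨h3, h4⟩
end
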